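/- The k-linear map M_S → H*_S sending μ(τ) to [m(τ)] vanishes on J_S, and the induced k-linear map H_{*S} → H*_S, [μ(τ)] ↦ [m(τ)], is an isomorphism of k-modules. Equivalently, the standard relations span all k-linear relations between the classes of the good monomials m(τ) in H*_S. -/

import Mathlib

open scoped Classical
noncomputable section

namespace EMO

/-- `σ` is an unordered 2-partition of the set `X`: two distinct nonempty disjoint parts
whose union is `X`. -/
def IsTwoPartitionOn {γ : Type*} (X : Set γ) (σ : Set (Set γ)) : Prop :=
  ∃ A B : Set γ, σ = {A, B} ∧ A ≠ B ∧ A.Nonempty ∧ B.Nonempty ∧ Disjoint A B ∧ A ∪ B = X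

/-- unordered 2-partition of the whole set. -/
def IsTwoPartition {γ : Type*} (σ : Set (Set γ)) : Prop :=
  IsTwoPartitionOn Set.univ σ

/-- `δ(σ,τ)`: the number of nonempty pairwise distinct sets among the intersections
`A ∩ B`, `A ∈ σ`, `B ∈ τ`, minus 2. -/
def delta {γ : Type*} (σ τ : Set (Set γ)) : ℤ :=
  ({C : Set γ | C.Nonempty ∧ ∃ A ∈ σ, ∃ B ∈ τ, C = A ∩ B}.ncard : ℤ) - 2

/-- `a b σ c d` : the elements `a,b` lie in one part of `σ` and `c,d` in the other. -/
def SplitsPair {γ : Type*} (σ : Set (Set γ)) (a b c d : γ) : Prop :=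
  ∃ A ∈ σ, ∃ B ∈ σ, A ≠ B ∧ a ∈ A ∧ b ∈ A ∧ c ∈ B ∧ d ∈ B

/-- a painted stable 2-partition w.r.t. the set `W` of white elements: each part
contains a white element and has at least two elements. -/
def PaintedStablePart {γ : Type*} (W : Set γ) (σ : Set (Set γ)) : Prop :=
  IsTwoPartition σ ∧ ∀ A ∈ σ, (A ∩ W).Nonempty ∧ 2 ≤ A.ncard

/-- a good family of painted stable 2-partitions: pairwise `δ = 1`. -/
def GoodFamily {γ : Type*} (W : Set γ) (E : Set (Set (Set γ))) : Prop :=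
  (∀ σ ∈ E, PaintedStablePart W σ) ∧ ∀ σ ∈ E, ∀ σ' ∈ E, σ ≠ σ' → delta σ σ' = 1

/-- an allowed quadruple: pairwise distinct, and each of the pairs
`{i,j}`, `{k,l}`, `{k,j}`, `{i,l}` contains a white element. -/
def Allowed {γ : Type*} (W : Set γ) (i j k l : γ) : Prop :=
  i ≠ j ∧ i ≠ k ∧ i ≠ l ∧ j ≠ k ∧ j ≠ l ∧ k ≠ l ∧
  (i ∈ W ∨ j ∈ W) ∧ (k ∈ W ∨ l ∈ W) ∧ (k ∈ W ∨ j ∈ W) ∧ (i ∈ W ∨ l ∈ W)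

/-- `ε(σ; i,j,k,l)`. -/
def eps {γ : Type*} (σ : Set (Set γ)) (i j k l : γ) : ℤ :=
  if SplitsPair σ i j k l then 1 else if SplitsPair σ k j i l then -1 else 0

/-- A tree whose tails are bijectively labeled by `γ`: a finite graph
(vertices, flags, incidence map, involution) whose geometric realization is
connected and simply connected (edge count), together with a labeling of the tails. -/
structure LTree (γ : Type) where
  V : Type
  Fl : Type
  [finV : Finite V]
  [finF : Finite Fl]
  bd : Fl → V
  inv : Fl → Fl
  inv_inv : ∀ f, inv (inv f) = f
  label : γ → Fl
  label_fixed : ∀ s, inv (label s) = label s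
  label_inj : Function.Injective label
  label_surj : ∀ f, inv f = f → ∃ s, label s = f
  conn : ∀ v w : V, Relation.ReflTransGen (fun a b => ∃ f, bd f = a ∧ bd (inv f) = b) v w
  tree_count : Nat.card {f : Fl // inv f ≠ f} + 2 = 2 * Nat.card V

attribute [instance] LTree.finV LTree.finF

namespace LTree

variable {γ : Type} (τ : LTree γ)

/-- flags incident to a vertex. -/
def flagsAt (v : τ.V) : Set τ.Fl := {f | τ.bd f = v}

/-- adjacency avoiding the edge `{f, inv f}`. -/
def sideAdj (f : τ.Fl) (a b : τ.V) : Prop :=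
  ∃ g, g ≠ f ∧ g ≠ τ.inv f ∧ τ.bd g = a ∧ τ.bd (τ.inv g) = b

/-- labels lying on the `f`-side of the edge `{f, inv f}`. -/
def flagSide (f : τ.Fl) : Set γ :=
  {s | Relation.ReflTransGen (τ.sideAdj f) (τ.bd (τ.label s)) (τ.bd f)}

/-- the 2-partition `σ_e` of the labels determined by the edge `{f, inv f}`. -/
def flagPartition (f : τ.Fl) : Set (Set γ) := {τ.flagSide f, τ.flagSide (τ.inv f)}

/-- the family of 2-partitions of labels determined by the edges of `τ`. -/
def edgeFamily : Set (Set (Set γ)) := {σ | ∃ f, τ.inv f ≠ f ∧ τ.flagPartition f = σ}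

/-- painted stability: every vertex carries at least three flags, and every
end vertex carries a white tail. -/
def PaintedStable (W : Set γ) : Prop :=
  (∀ v : τ.V, 3 ≤ Nat.card {f : τ.Fl // τ.bd f = v}) ∧
  (∀ v : τ.V, Nat.card {f : τ.Fl // τ.bd f = v ∧ τ.inv f ≠ f} ≤ 1 →
    ∃ s ∈ W, τ.bd (τ.label s) = v)

/-- adjacency avoiding the vertex `v`. -/
def avoidAdj (v : τ.V) (a b : τ.V) : Prop :=
  a ≠ v ∧ b ≠ v ∧ ∃ g, τ.bd g = a ∧ τ.bd (τ.inv g) = b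

/-- the labels carried by the branch of `τ` at `v` starting with the flag `φ`. -/
def branchLabels (v : τ.V) (φ : τ.Fl) : Set γ :=
  {s | τ.label s = φ ∨
    (τ.inv φ ≠ φ ∧ Relation.ReflTransGen (τ.avoidAdj v) (τ.bd (τ.inv φ)) (τ.bd (τ.label s)))}

/-- the 2-partition of labels induced by a 2-partition `α` of the flags at `v`. -/
def inducedSPart (v : τ.V) (α : Set (Set τ.Fl)) : Set (Set γ) :=
  (fun A => ⋃ φ ∈ A, τ.branchLabels v φ) '' α

/-- painted stable 2-partitions of the set of flags at `v`. -/
def VertexParts (W : Set γ) (v : τ.V) : Set (Set (Set τ.Fl)) :=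
  {α | IsTwoPartitionOn (τ.flagsAt v) α ∧ PaintedStablePart W (τ.inducedSPart v α)}

/-- an allowed quadruple of (pairwise distinct) flags at the vertex `v`: there are
labels on the corresponding branches forming an allowed quadruple. -/
def AllowedFlags (W : Set γ) (v : τ.V) (I J K L : τ.Fl) : Prop :=
  I ∈ τ.flagsAt v ∧ J ∈ τ.flagsAt v ∧ K ∈ τ.flagsAt v ∧ L ∈ τ.flagsAt v ∧
  I ≠ J ∧ I ≠ K ∧ I ≠ L ∧ J ≠ K ∧ J ≠ L ∧ K ≠ L ∧
  ∃ i ∈ τ.branchLabels v I, ∃ j ∈ τ.branchLabels v J,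
    ∃ a ∈ τ.branchLabels v K, ∃ b ∈ τ.branchLabels v L, Allowed W i j a b

end LTree

/-- an `S`-isomorphism of labeled trees (flags mapped in the reverse direction). -/
structure SIso {γ : Type} (τ τ' : LTree γ) where
  vmap : τ.V ≃ τ'.V
  fmap : τ'.Fl ≃ τ.Fl
  bd_comp : ∀ f : τ'.Fl, τ'.bd f = vmap (τ.bd (fmap f))
  inv_comp : ∀ f : τ'.Fl, fmap (τ'.inv f) = τ.inv (fmap f)
  label_comp : ∀ s : γ, fmap (τ'.label s) = τ.label s

/-- a morphism `τ' → τ` of labeled trees contracting the edge `{e₁, inv e₁}` of `τ'`. -/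
structure Contraction {γ : Type} (τ' τ : LTree γ) (e₁ : τ'.Fl) where
  cF : τ.Fl → τ'.Fl
  cV : τ'.V → τ.V
  cF_inj : Function.Injective cF
  cF_range : Set.range cF = {f : τ'.Fl | f ≠ e₁ ∧ f ≠ τ'.inv e₁}
  cF_inv : ∀ f, cF (τ.inv f) = τ'.inv (cF f)
  cF_label : ∀ s : γ, cF (τ.label s) = τ'.label s
  cV_surj : Function.Surjective cV
  cV_bd : ∀ f : τ.Fl, cV (τ'.bd (cF f)) = τ.bd f
  cV_glue : cV (τ'.bd e₁) = cV (τ'.bd (τ'.inv e₁))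
  cV_almost_inj : ∀ v w : τ'.V, cV v = cV w →
    v = w ∨ (({v, w} : Set τ'.V) = {τ'.bd e₁, τ'.bd (τ'.inv e₁)})

/-- the polynomial ring `R_S = k[l_σ]` on variables indexed by painted stable
2-partitions. -/
abbrev PSP (γ : Type) (W : Set γ) := {σ : Set (Set γ) // PaintedStablePart W σ}

abbrev Rring (γ : Type) (W : Set γ) (k : Type) [CommRing k] := MvPolynomial (PSP γ W) k

/-- the variable `l_σ` (or `0` if `σ` is not painted stable). -/
def lvar (γ : Type) (W : Set γ) (k : Type) [CommRing k] (σ : Set (Set γ)) : Rring γ W k :=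
  if h : PaintedStablePart W σ then MvPolynomial.X ⟨σ, h⟩ else 0

/-- the element `R_{ijkl} = Σ_σ ε(σ; i,j,k,l) l_σ`. -/
def Rquad (γ : Type) (W : Set γ) (k : Type) [CommRing k] (i j a b : γ) : Rring γ W k :=
  ∑ᶠ σ : PSP γ W, eps σ.1 i j a b • MvPolynomial.X σ

/-- the ideal `I_S` generated by the `R_{ijkl}` (over allowed quadruples) and the
products `l_σ l_σ'` for crossing pairs `σ, σ'`. -/
def idealI (γ : Type) (W : Set γ) (k : Type) [CommRing k] : Ideal (Rring γ W k) :=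
  Ideal.span
    ({p | ∃ i j a b : γ, Allowed W i j a b ∧ p = Rquad γ W k i j a b} ∪
     {p | ∃ σ σ' : PSP γ W, (∃ i j a b : γ, Allowed W i j a b ∧
        SplitsPair σ.1 i j a b ∧ SplitsPair σ'.1 a j i b) ∧
        p = MvPolynomial.X σ * MvPolynomial.X σ'})

/-- the good monomial `∏_{σ ∈ E} l_σ` of a family `E` of 2-partitions. -/
def mFam (γ : Type) (W : Set γ) (k : Type) [CommRing k] (E : Set (Set (Set γ))) :
    Rring γ W k :=
  ∏ᶠ σ ∈ E, lvar γ W k σ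

/-- the combinatorial cohomology ring `H*_S = R_S/I_S`. -/
abbrev HS (γ : Type) (W : Set γ) (k : Type) [CommRing k] := Rring γ W k ⧸ idealI γ W k

/-- good families of painted stable 2-partitions (= iso classes of painted stable trees). -/
abbrev GoodFam (γ : Type) (W : Set γ) := {E : Set (Set (Set γ)) // GoodFamily W E}

/-- the free `k`-module `M_S` on the iso classes `μ(τ)` of painted stable `S`-trees,
encoded by their families of edge 2-partitions. -/
abbrev MS (γ : Type) (W : Set γ) (k : Type) [CommRing k] := GoodFam γ W →₀ k

/-- the basis element `μ(τ)` of `M_S` attached to the edge family `E` of `τ`. -/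
def muE (γ : Type) (W : Set γ) (k : Type) [CommRing k] (E : Set (Set (Set γ))) : MS γ W k :=
  if h : GoodFamily W E then Finsupp.single ⟨E, h⟩ 1 else 0

/-- the standard relation `r(τ, v; I,J,K,L) = Σ_α ε(α; I,J,K,L) μ(τ(α))`. -/
def stdRelH (γ : Type) (W : Set γ) (k : Type) [CommRing k]
    (τ : LTree γ) (v : τ.V) (I J K L : τ.Fl) : MS γ W k :=
  ∑ᶠ α ∈ τ.VertexParts W v, eps α I J K L • muE γ W k (τ.edgeFamily ∪ {τ.inducedSPart v α})

/-- the span `J_S` of the standard relations. -/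
def JS (γ : Type) (W : Set γ) (k : Type) [CommRing k] : Submodule k (MS γ W k) :=
  Submodule.span k {x | ∃ τ : LTree γ, τ.PaintedStable W ∧ ∃ (v : τ.V) (I J K L : τ.Fl),
    τ.AllowedFlags W v I J K L ∧ x = stdRelH γ W k τ v I J K L}

/-- the combinatorial homology `H_{*S} = M_S/J_S`. -/
abbrev HsLow (γ : Type) (W : Set γ) (k : Type) [CommRing k] := MS γ W k ⧸ JS γ W k

end EMO

namespace EMO

/-- the `k`-linear map `M_S → H*_S` sending `μ(τ)` to `[m(τ)]`. -/
def sMap (γ : Type) [Finite γ] (W : Set γ) (k : Type) [CommRing k] :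
    MS γ W k →ₗ[k] HS γ W k :=
  Finsupp.linearCombination k
    (fun E : GoodFam γ W => Ideal.Quotient.mk (idealI γ W k) (mFam γ W k E.1))

section FlagComplex

variable {P G k : Type*} [CommRing k]

/-- The faces of the flag complex of a relation `C`. -/
def IsFace (C : P → P → Prop) (F : Finset P) : Prop :=
  ∀ p ∈ F, ∀ q ∈ F, p ≠ q → C p q

lemma IsFace.mono {C : P → P → Prop} {F F' : Finset P} (h : IsFace C F) (hF : F' ⊆ F) :
    IsFace C F' :=
  fun p hp q hq => h p (hF hp) q (hF hq)

/-- Every coordinate of every face is the restriction of an element of `L`. -/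
def Unimodular (C : P → P → Prop) (L : Submodule k (P → k)) : Prop :=
  ∀ F, IsFace C F → ∀ p ∈ F, ∃ l ∈ L, l p = 1 ∧ ∀ q ∈ F, q ≠ p → l q = 0

variable {C : P → P → Prop} (ι : G ≃ {F : Finset P // IsFace C F})

/-- The basis vector of a face, and `0` for a nonface. -/
def faceVec (F : Finset P) : G →₀ k :=
  if h : IsFace C F then Finsupp.single (ι.symm ⟨F, h⟩) 1 else 0

lemma faceVec_of_not {F : Finset P} (h : ¬ IsFace C F) : faceVec (k := k) ι F = 0 := by
  simp [faceVec, h]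

lemma faceVec_apply_equiv (g : G) : faceVec (k := k) ι (ι g).1 = Finsupp.single g 1 := by
  simp [faceVec, (ι g).2]

variable [Fintype P] [DecidableEq P]

/-- The relation of a linear form on the link of `F`. -/
def linkRel (F : Finset P) (l : P → k) : G →₀ k :=
  ∑ q ∈ Fᶜ, l q • faceVec ι (insert q F)

/-- The span of the relations given by the linear forms in `L` vanishing on a face. -/
def linkSpan (L : Submodule k (P → k)) : Submodule k (G →₀ k) :=
  Submodule.span k {x | ∃ F l, IsFace C F ∧ l ∈ L ∧ (∀ q ∈ F, l q = 0) ∧ x = linkRel ι F l}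

variable (L : Submodule k (P → k))

/-- The class of a face modulo the link relations. -/
def faceCls (F : Finset P) : (G →₀ k) ⧸ linkSpan ι L := (linkSpan ι L).mkQ (faceVec ι F)

lemma faceCls_of_not {F : Finset P} (h : ¬ IsFace C F) : faceCls ι L F = 0 := by
  simp [faceCls, faceVec_of_not ι h]

lemma faceCls_insert_of_not {F : Finset P} (h : ¬ IsFace C F) (q : P) :
    faceCls ι L (insert q F) = 0 :=
  faceCls_of_not ι L fun h' => h (h'.mono (Finset.subset_insert _ _))

/-- The class of `linkRel`, as a linear function of the linear form. -/
def linkCls (F : Finset P) : (P → k) →ₗ[k] (G →₀ k) ⧸ linkSpan ι L :=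
  ∑ q ∈ Fᶜ, (LinearMap.proj q).smulRight (faceCls ι L (insert q F))

lemma linkCls_apply (F : Finset P) (l : P → k) :
    linkCls ι L F l = ∑ q ∈ Fᶜ, l q • faceCls ι L (insert q F) := by
  simp [linkCls]

lemma mkQ_linkRel (F : Finset P) (l : P → k) :
    (linkSpan ι L).mkQ (linkRel ι F l) = linkCls ι L F l := by
  simp only [linkRel, linkCls_apply, map_sum, map_smul, faceCls]

lemma linkCls_of_not {F : Finset P} (h : ¬ IsFace C F) (l : P → k) :
    linkCls ι L F l = 0 := by
  rw [linkCls_apply]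
  exact Finset.sum_eq_zero fun q _ => by rw [faceCls_insert_of_not ι L h, smul_zero]

lemma linkCls_eq_zero {F : Finset P} {l : P → k} (hl : l ∈ L) (h0 : ∀ q ∈ F, l q = 0) :
    linkCls ι L F l = 0 := by
  by_cases hF : IsFace C F
  · rw [← mkQ_linkRel]
    exact (Submodule.Quotient.mk_eq_zero _).2 (Submodule.subset_span ⟨F, l, hF, hl, h0, rfl⟩)
  · exact linkCls_of_not ι L hF l

lemma exists_actVal (hU : Unimodular C L) (p : P) (F : Finset P) :
    ∃ n : (G →₀ k) ⧸ linkSpan ι L, (p ∉ F → n = faceCls ι L (insert p F)) ∧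
      (p ∈ F → ∀ l ∈ L, l p = 1 → (∀ q ∈ F, q ≠ p → l q = 0) → n = - linkCls ι L F l) ∧
      (¬ IsFace C F → n = 0) := by
  by_cases hF : IsFace C F
  · by_cases hp : p ∈ F
    · obtain ⟨l, hl, h1, h0⟩ := hU F hF p hp
      refine ⟨- linkCls ι L F l, fun h => absurd hp h, fun _ l' hl' h1' h0' => ?_,
        fun h => absurd hF h⟩
      rw [neg_inj, ← sub_eq_zero, ← map_sub]
      refine linkCls_eq_zero ι L (L.sub_mem hl hl') fun q hq => ?_
      by_cases hqp : q = p
      · subst hqp; simp [h1, h1']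
      · simp [h0 q hq hqp, h0' q hq hqp]
    · exact ⟨_, fun _ => rfl, fun h => absurd h hp, fun h => absurd hF h⟩
  · exact ⟨0, fun _ => (faceCls_insert_of_not ι L hF p).symm,
      fun _ l _ _ _ => by rw [linkCls_of_not ι L hF, neg_zero], fun _ => rfl⟩

/-- The product of a variable with a face monomial, in the face module. -/
def actVal (hU : Unimodular C L) (p : P) (F : Finset P) : (G →₀ k) ⧸ linkSpan ι L :=
  Classical.choose (exists_actVal ι L hU p F)

variable {L} (hU : Unimodular C L)

lemma actVal_of_notMem {p : P} {F : Finset P} (hp : p ∉ F) :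
    actVal ι L hU p F = faceCls ι L (insert p F) :=
  (Classical.choose_spec (exists_actVal ι L hU p F)).1 hp

lemma actVal_of_mem {p : P} {F : Finset P} (hp : p ∈ F) {l : P → k} (hl : l ∈ L)
    (h1 : l p = 1) (h0 : ∀ q ∈ F, q ≠ p → l q = 0) :
    actVal ι L hU p F = - linkCls ι L F l :=
  (Classical.choose_spec (exists_actVal ι L hU p F)).2.1 hp l hl h1 h0

lemma actVal_of_not {p : P} {F : Finset P} (hF : ¬ IsFace C F) : actVal ι L hU p F = 0 :=
  (Classical.choose_spec (exists_actVal ι L hU p F)).2.2 hF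

lemma sum_linkCls_comm (F : Finset P) (l l' : P → k) :
    ∑ q ∈ Fᶜ, l q • linkCls ι L (insert q F) l' =
      ∑ q ∈ Fᶜ, l' q • linkCls ι L (insert q F) l := by
  simp only [linkCls_apply, Finset.smul_sum]
  rw [Finset.sum_comm' (t' := Fᶜ) (s' := fun q => (insert q F)ᶜ)]
  · refine Finset.sum_congr rfl fun q _ => Finset.sum_congr rfl fun s _ => ?_
    rw [smul_smul, smul_smul, mul_comm, Finset.insert_comm]
  · intro x y
    simp only [Finset.mem_compl, Finset.mem_insert, not_or]
    grind

include hU in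
lemma exists_insert_cls (F : Finset P) (q : P) (hq : q ∉ F) :
    ∃ n : (G →₀ k) ⧸ linkSpan ι L,
      (∀ p ∈ F, ∀ l ∈ L, l p = 1 → (∀ q ∈ F, q ≠ p → l q = 0) →
        actVal ι L hU p (insert q F) = - linkCls ι L (insert q F) l + l q • n) ∧
      ∀ l ∈ L, (∀ q ∈ F, l q = 0) → linkCls ι L (insert q F) l = l q • n := by
  by_cases hF : IsFace C (insert q F)
  · obtain ⟨m, hm, h1, h0⟩ := hU _ hF q (Finset.mem_insert_self _ _)
    have h0' : ∀ r ∈ F, m r = 0 := fun r hr =>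
      h0 r (Finset.mem_insert_of_mem hr) (fun h => hq (h ▸ hr))
    refine ⟨linkCls ι L (insert q F) m, fun p hp l hl hl1 hl0 => ?_, fun l hl hl0 => ?_⟩
    · rw [actVal_of_mem ι hU (Finset.mem_insert_of_mem hp)
        (L.sub_mem hl (L.smul_mem (l q) hm))]
      · rw [map_sub, map_smul]; abel
      · simp [hl1, h0' p hp]
      · intro r hr hrp
        rcases Finset.mem_insert.1 hr with rfl | hr
        · simp [h1]
        · simp [hl0 r hr hrp, h0' r hr]
    · rw [← sub_eq_zero, ← map_smul, ← map_sub]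
      refine linkCls_eq_zero ι L (L.sub_mem hl (L.smul_mem (l q) hm)) fun r hr => ?_
      rcases Finset.mem_insert.1 hr with rfl | hr
      · simp [h1]
      · simp [hl0 r hr, h0' r hr]
  · exact ⟨0, fun p hp l _ _ _ => by
      rw [actVal_of_not ι hU hF, linkCls_of_not ι L hF]; simp, fun l _ _ => by
      rw [linkCls_of_not ι L hF]; simp⟩

/-- Multiplication by a variable, before passing to the quotient. -/
def preAct (p : P) : (G →₀ k) →ₗ[k] (G →₀ k) ⧸ linkSpan ι L :=
  Finsupp.linearCombination k fun g => actVal ι L hU p (ι g).1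

lemma preAct_faceVec (p : P) (F : Finset P) :
    preAct ι hU p (faceVec ι F) = actVal ι L hU p F := by
  by_cases hF : IsFace C F
  · simp [preAct, faceVec, hF]
  · rw [faceVec_of_not ι hF, map_zero, actVal_of_not ι hU hF]

lemma preAct_linkRel (p : P) (F : Finset P) (l : P → k) :
    preAct ι hU p (linkRel ι F l) = ∑ q ∈ Fᶜ, l q • actVal ι L hU p (insert q F) := by
  simp only [linkRel, map_sum, map_smul, preAct_faceVec]

lemma linkSpan_le_ker (p : P) : linkSpan ι L ≤ LinearMap.ker (preAct ι hU p) := by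
  refine Submodule.span_le.2 ?_
  rintro _ ⟨F, l, hF, hl, h0, rfl⟩
  rw [SetLike.mem_coe, LinearMap.mem_ker, preAct_linkRel]
  by_cases hp : p ∈ F
  · obtain ⟨m, hm, hm1, hm0⟩ := hU F hF p hp
    have key : ∀ q ∈ Fᶜ, l q • actVal ι L hU p (insert q F) =
        m q • linkCls ι L (insert q F) l - l q • linkCls ι L (insert q F) m := by
      intro q hq
      obtain ⟨n, hn, hn'⟩ := exists_insert_cls ι hU F q (Finset.mem_compl.1 hq)
      rw [hn p hp m hm hm1 hm0, hn' l hl h0]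
      module
    rw [Finset.sum_congr rfl key, Finset.sum_sub_distrib, sum_linkCls_comm, sub_self]
  · have key : ∀ q ∈ (insert p F)ᶜ, l q • actVal ι L hU p (insert q F) =
        l q • faceCls ι L (insert q (insert p F)) := by
      intro q hq
      simp only [Finset.mem_compl, Finset.mem_insert, not_or] at hq
      rw [actVal_of_notMem ι hU, Finset.insert_comm]
      simp [hp, Ne.symm hq.1]
    have hsplit : Fᶜ = insert p (insert p F)ᶜ := by
      ext q; by_cases h : q = p <;> simp [h, hp]
    rw [hsplit, Finset.sum_insert (by simp), Finset.sum_congr rfl key, ← linkCls_apply]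
    by_cases hF' : IsFace C (insert p F)
    · obtain ⟨m, hm, hm1, hm0⟩ := hU _ hF' p (Finset.mem_insert_self _ _)
      rw [actVal_of_mem ι hU (Finset.mem_insert_self _ _) hm hm1 hm0, smul_neg,
        neg_add_eq_zero, ← sub_eq_zero, ← map_smul, ← map_sub]
      refine linkCls_eq_zero ι L (L.sub_mem (L.smul_mem _ hm) hl) fun q hq => ?_
      rcases Finset.mem_insert.1 hq with rfl | hq
      · simp [hm1]
      · simp [h0 q hq, hm0 q (Finset.mem_insert_of_mem hq) fun h => hp (h ▸ hq)]
    · rw [actVal_of_not ι hU hF', linkCls_of_not ι L hF']; simp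

/-- Multiplication by a variable on the face module. -/
def act (p : P) : Module.End k ((G →₀ k) ⧸ linkSpan ι L) :=
  (linkSpan ι L).liftQ (preAct ι hU p) (linkSpan_le_ker ι hU p)

lemma act_faceCls (p : P) (F : Finset P) :
    act ι hU p (faceCls ι L F) = actVal ι L hU p F := by
  rw [← preAct_faceVec]; rfl

lemma act_linkCls (p : P) (F : Finset P) (l : P → k) :
    act ι hU p (linkCls ι L F l) = ∑ q ∈ Fᶜ, l q • actVal ι L hU p (insert q F) := by
  simp only [linkCls_apply, map_sum, map_smul, act_faceCls]

lemma end_ext {f g : Module.End k ((G →₀ k) ⧸ linkSpan ι L)}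
    (h : ∀ F, IsFace C F → f (faceCls ι L F) = g (faceCls ι L F)) : f = g := by
  refine Submodule.linearMap_qext _ (Finsupp.lhom_ext' fun a => LinearMap.ext_ring ?_)
  have := h (ι a).1 (ι a).2
  rw [faceCls, faceVec_apply_equiv] at this
  exact this

lemma act_comm_of_mem_of_notMem {p q : P} {F : Finset P} (hF : IsFace C F) (hp : p ∈ F)
    (hq : q ∉ F) :
    act ι hU q (act ι hU p (faceCls ι L F)) = act ι hU p (act ι hU q (faceCls ι L F)) := by
  rw [act_faceCls, act_faceCls, actVal_of_notMem ι hU hq, act_faceCls]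
  obtain ⟨m, hm, hm1, hm0⟩ := hU F hF p hp
  rw [actVal_of_mem ι hU hp hm hm1 hm0, map_neg, act_linkCls]
  obtain ⟨n, hn, -⟩ := exists_insert_cls ι hU F q hq
  rw [hn p hp m hm hm1 hm0]
  have key : ∀ s ∈ (insert q F)ᶜ, m s • actVal ι L hU q (insert s F) =
      m s • faceCls ι L (insert s (insert q F)) := by
    intro s hs
    simp only [Finset.mem_compl, Finset.mem_insert, not_or] at hs
    rw [actVal_of_notMem ι hU, Finset.insert_comm]
    simp [hq, Ne.symm hs.1]
  have hsplit : Fᶜ = insert q (insert q F)ᶜ := by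
    ext r; by_cases h : r = q <;> simp [h, hq]
  rw [hsplit, Finset.sum_insert (by simp), Finset.sum_congr rfl key, ← linkCls_apply]
  by_cases hF' : IsFace C (insert q F)
  · obtain ⟨m', hm', hm1', hm0'⟩ := hU _ hF' q (Finset.mem_insert_self _ _)
    have h1 := actVal_of_mem ι hU (Finset.mem_insert_self _ _) hm' hm1' hm0'
    have h2 := hn p hp m hm hm1 hm0
    rw [h1, ← h2]
    rw [actVal_of_mem ι hU (Finset.mem_insert_of_mem hp)
        (L.sub_mem hm (L.smul_mem (m q) hm'))]
    · rw [map_sub, map_smul]; module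
    · simp [hm1, hm0' p (Finset.mem_insert_of_mem hp) fun h => hq (h ▸ hp)]
    · intro r hr hrp
      rcases Finset.mem_insert.1 hr with rfl | hr'
      · simp [hm1']
      · simp [hm0 r hr' hrp, hm0' r hr fun h => hq (h ▸ hr')]
  · rw [← hn p hp m hm hm1 hm0, actVal_of_not ι hU hF', actVal_of_not ι hU hF',
      linkCls_of_not ι L hF']
    simp

lemma act_comm (p q : P) : act ι hU p * act ι hU q = act ι hU q * act ι hU p := by
  refine end_ext ι fun F hF => ?_
  simp only [Module.End.mul_apply]
  by_cases hpq : p = q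
  · rw [hpq]
  by_cases hp : p ∈ F <;> by_cases hq : q ∈ F
  · obtain ⟨m, hm, hm1, hm0⟩ := hU F hF p hp
    obtain ⟨m', hm', hm1', hm0'⟩ := hU F hF q hq
    rw [act_faceCls, act_faceCls, actVal_of_mem ι hU hp hm hm1 hm0,
      actVal_of_mem ι hU hq hm' hm1' hm0', map_neg, map_neg, act_linkCls, act_linkCls, neg_inj]
    have key : ∀ s ∈ Fᶜ, m' s • actVal ι L hU p (insert s F) -
        m s • actVal ι L hU q (insert s F) =
        m s • linkCls ι L (insert s F) m' - m' s • linkCls ι L (insert s F) m := by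
      intro s hs
      obtain ⟨n, hn, -⟩ := exists_insert_cls ι hU F s (Finset.mem_compl.1 hs)
      rw [hn p hp m hm hm1 hm0, hn q hq m' hm' hm1' hm0']
      module
    rw [← sub_eq_zero, ← Finset.sum_sub_distrib, Finset.sum_congr rfl key,
      Finset.sum_sub_distrib, sum_linkCls_comm, sub_self]
  · exact (act_comm_of_mem_of_notMem ι hU hF hp hq).symm
  · exact act_comm_of_mem_of_notMem ι hU hF hq hp
  · rw [act_faceCls, act_faceCls, actVal_of_notMem ι hU hp, actVal_of_notMem ι hU hq,
      act_faceCls, act_faceCls, actVal_of_notMem ι hU (by simp [hpq, hp]),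
      actVal_of_notMem ι hU (by simp [Ne.symm hpq, hq]), Finset.insert_comm]

lemma act_mul_eq_zero {p q : P} (hpq : p ≠ q) (hC : ¬ C p q) :
    act ι hU p * act ι hU q = 0 := by
  have hn : ∀ F : Finset P, p ∈ F → q ∈ F → ¬ IsFace C F :=
    fun F hp hq hF => hC (hF p hp q hq hpq)
  have main : ∀ F : Finset P, p ∉ F → act ι hU p (act ι hU q (faceCls ι L F)) = 0 ∨ q ∈ F := by
    intro F hp
    by_cases hq : q ∈ F
    · exact Or.inr hq
    · left
      rw [act_faceCls, actVal_of_notMem ι hU hq, act_faceCls,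
        actVal_of_notMem ι hU (by simp [hpq, hp])]
      exact faceCls_of_not ι L (hn _ (by simp) (by simp))
  refine end_ext ι fun F hF => ?_
  simp only [LinearMap.zero_apply]
  by_cases hq : q ∈ F
  · have hp : p ∉ F := fun hp => hn F hp hq hF
    rw [act_comm, Module.End.mul_apply, act_faceCls, actVal_of_notMem ι hU hp, act_faceCls]
    exact actVal_of_not ι hU (hn _ (by simp) (by simp [hq]))
  · rw [Module.End.mul_apply, act_faceCls, actVal_of_notMem ι hU hq, act_faceCls]
    by_cases hp : p ∈ F
    · exact actVal_of_not ι hU (hn _ (by simp [hp]) (by simp))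
    · rw [actVal_of_notMem ι hU (by simp [hpq, hp])]
      exact faceCls_of_not ι L (hn _ (by simp) (by simp))

lemma sum_smul_act_eq_zero {l : P → k} (hl : l ∈ L) : ∑ p, l p • act ι hU p = 0 := by
  refine end_ext ι fun F hF => ?_
  simp only [LinearMap.sum_apply, LinearMap.smul_apply, act_faceCls, LinearMap.zero_apply]
  have hm : ∀ p : P, ∃ m : P → k, p ∈ F → m ∈ L ∧ m p = 1 ∧ ∀ q ∈ F, q ≠ p → m q = 0 := by
    intro p
    by_cases hp : p ∈ F
    · obtain ⟨m, h1, h2⟩ := hU F hF p hp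
      exact ⟨m, fun _ => ⟨h1, h2⟩⟩
    · exact ⟨0, fun h => absurd h hp⟩
  choose m hm using hm
  rw [← Finset.sum_add_sum_compl F]
  have h1 : ∀ p ∈ F, l p • actVal ι L hU p F = - linkCls ι L F (l p • m p) := by
    intro p hp
    obtain ⟨hm0, hm1, hm2⟩ := hm p hp
    rw [actVal_of_mem ι hU hp hm0 hm1 hm2, map_smul, smul_neg]
  have h2 : ∀ p ∈ Fᶜ, l p • actVal ι L hU p F = l p • faceCls ι L (insert p F) :=
    fun p hp => by rw [actVal_of_notMem ι hU (Finset.mem_compl.1 hp)]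
  rw [Finset.sum_congr rfl h1, Finset.sum_congr rfl h2, ← linkCls_apply,
    Finset.sum_neg_distrib, neg_add_eq_zero, ← map_sum, ← sub_eq_zero, ← map_sub]
  refine linkCls_eq_zero ι L (L.sub_mem (L.sum_mem fun p hp => L.smul_mem _ (hm p hp).1) hl)
    fun q hq => ?_
  rw [Pi.sub_apply, Finset.sum_apply, Finset.sum_eq_single_of_mem q hq]
  · simp [(hm q hq).2.1]
  · intro p hp hpq
    simp [(hm p hp).2.2 q hq (Ne.symm hpq)]

open scoped IsMulCommutative in
lemma exists_aeval_act :
    ∃ Φ : MvPolynomial P k →ₐ[k] Module.End k ((G →₀ k) ⧸ linkSpan ι L),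
      ∀ p, Φ (MvPolynomial.X p) = act ι hU p := by
  let A : Subalgebra k (Module.End k ((G →₀ k) ⧸ linkSpan ι L)) :=
    Algebra.adjoin k (Set.range (act ι hU))
  have : IsMulCommutative A := Algebra.isMulCommutative_adjoin k (by
    rintro _ ⟨p, rfl⟩ _ ⟨q, rfl⟩
    exact act_comm ι hU p q)
  let f : MvPolynomial P k →ₐ[k] A :=
    MvPolynomial.aeval fun p => (⟨act ι hU p, Algebra.subset_adjoin ⟨p, rfl⟩⟩ : A)
  refine ⟨A.val.comp f, fun p => ?_⟩
  simp [f]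

omit hU in
/-- The flag complex presentation: for a unimodular family `L` of linear forms, the face
monomials span the quotient of the face ring by `L`, and the link relations generate all the
linear relations between them. -/
theorem face_presentation (hU : Unimodular C L) (I : Ideal (MvPolynomial P k))
    (hL : ∀ l ∈ L, ∑ p, MvPolynomial.C (l p) * MvPolynomial.X p ∈ I)
    (hC : ∀ p q, p ≠ q → ¬ C p q → MvPolynomial.X p * MvPolynomial.X q ∈ I)
    (hI : I ≤ Ideal.span
      ({x | ∃ l ∈ L, x = ∑ p, MvPolynomial.C (l p) * MvPolynomial.X p} ∪
       {x | ∃ p q, p ≠ q ∧ ¬ C p q ∧ x = MvPolynomial.X p * MvPolynomial.X q}))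
    (s : (G →₀ k) →ₗ[k] MvPolynomial P k ⧸ I)
    (hs : ∀ g, s (Finsupp.single g 1) =
      Ideal.Quotient.mk I (∏ p ∈ (ι g).1, MvPolynomial.X p)) :
    LinearMap.ker s = linkSpan ι L ∧ LinearMap.range s = ⊤ := by
  set mon : Finset P → MvPolynomial P k := fun F => ∏ p ∈ F, MvPolynomial.X p with hmon
  have hnon : ∀ F : Finset P, ¬ IsFace C F → mon F ∈ I := by
    intro F hF
    simp only [IsFace, not_forall] at hF
    obtain ⟨p, hp, q, hq, hpq, h⟩ := hF
    have : mon F = (MvPolynomial.X p * MvPolynomial.X q) *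
        ∏ r ∈ (F.erase p).erase q, MvPolynomial.X r := by
      rw [mul_assoc, Finset.mul_prod_erase _ _ (Finset.mem_erase.2 ⟨Ne.symm hpq, hq⟩),
        Finset.mul_prod_erase _ _ hp]
    rw [this]
    exact I.mul_mem_right _ (hC p q hpq h)
  have hsv : ∀ F : Finset P, s (faceVec ι F) = Ideal.Quotient.mk I (mon F) := by
    intro F
    by_cases hF : IsFace C F
    · simp [faceVec, hF, hs, hmon]
    · rw [faceVec_of_not ι hF, map_zero, eq_comm, Ideal.Quotient.eq_zero_iff_mem]
      exact hnon F hF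
  have hsr : ∀ (F : Finset P) (l : P → k), l ∈ L → s (linkRel ι F l) =
      - ∑ p ∈ F, l p • Ideal.Quotient.mk I (MvPolynomial.X p * mon F) := by
    intro F l hl
    have h0 : ∑ p, l p • Ideal.Quotient.mk I (MvPolynomial.X p * mon F) = 0 := by
      have := I.mul_mem_right (mon F) (hL l hl)
      rw [← Ideal.Quotient.eq_zero_iff_mem] at this
      rw [← this, Finset.sum_mul, map_sum]
      refine Finset.sum_congr rfl fun p _ => ?_
      rw [mul_assoc, ← MvPolynomial.smul_eq_C_mul]
      rfl
    rw [← Finset.sum_add_sum_compl F, add_comm] at h0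
    rw [← add_eq_zero_iff_eq_neg, ← h0]
    congr 1
    simp only [linkRel, map_sum, map_smul, hsv]
    refine Finset.sum_congr rfl fun p hp => ?_
    rw [hmon]
    simp only
    rw [Finset.prod_insert (Finset.mem_compl.1 hp)]
  have hrel : ∀ F, mon F ∈ I ∨ IsFace C F := fun F =>
    (em (IsFace C F)).elim Or.inr fun h => Or.inl (hnon F h)
  refine ⟨le_antisymm ?_ ?_, ?_⟩
  · intro z hz
    obtain ⟨Φ, hΦ⟩ := exists_aeval_act ι hU
    let T : (G →₀ k) →ₗ[k] MvPolynomial P k :=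
      Finsupp.linearCombination k fun g => mon (ι g).1
    have hT : ∀ z, s z = Ideal.Quotient.mkₐ k I (T z) := by
      intro z
      have : s = (Ideal.Quotient.mkₐ k I).toLinearMap ∘ₗ T := by
        refine Finsupp.lhom_ext' fun g => LinearMap.ext_ring ?_
        simp [T, hs, hmon]
      rw [this]; rfl
    have hker : ∀ x ∈ I, Φ x = 0 := by
      intro x hx
      suffices h : _ ≤ RingHom.ker Φ.toRingHom from h (hI hx)
      · refine Ideal.span_le.2 ?_
        rintro _ (⟨l, hl, rfl⟩ | ⟨p, q, hpq, h, rfl⟩)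
        · change Φ _ = 0
          rw [map_sum, ← sum_smul_act_eq_zero ι hU hl]
          refine Finset.sum_congr rfl fun p _ => ?_
          rw [← MvPolynomial.smul_eq_C_mul, map_smul, hΦ]
        · change Φ _ = 0
          rw [map_mul, hΦ, hΦ, act_mul_eq_zero ι hU hpq h]
    have hΦmon : ∀ F : Finset P, Φ (mon F) (faceCls ι L ∅) = faceCls ι L F := by
      intro F
      induction F using Finset.induction_on with
      | empty => simp [hmon]
      | insert p F hp ih =>
        rw [hmon] at ih ⊢
        simp only at ih ⊢
        rw [Finset.prod_insert hp, map_mul, Module.End.mul_apply, ih, hΦ, act_faceCls,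
          actVal_of_notMem ι hU hp]
    have hΦT : ∀ z, Φ (T z) (faceCls ι L ∅) = (linkSpan ι L).mkQ z := by
      intro z
      have : (LinearMap.applyₗ (faceCls ι L ∅)) ∘ₗ Φ.toLinearMap ∘ₗ T = (linkSpan ι L).mkQ := by
        refine Finsupp.lhom_ext' fun g => LinearMap.ext_ring ?_
        simp only [T, LinearMap.comp_apply, Finsupp.lsingle_apply,
          Finsupp.linearCombination_single, one_smul, LinearMap.applyₗ_apply_apply,
          AlgHom.toLinearMap_apply, hΦmon]
        rw [faceCls, faceVec_apply_equiv]
      rw [← this]; rfl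
    rw [LinearMap.mem_ker, hT] at hz
    have hz' : T z ∈ I := Ideal.Quotient.eq_zero_iff_mem.1 hz
    have := hΦT z
    rw [hker _ hz', LinearMap.zero_apply, eq_comm] at this
    exact (Submodule.Quotient.mk_eq_zero _).1 this
  · refine Submodule.span_le.2 ?_
    rintro _ ⟨F, l, hF, hl, h0, rfl⟩
    rw [SetLike.mem_coe, LinearMap.mem_ker, hsr F l hl, neg_eq_zero]
    exact Finset.sum_eq_zero fun p hp => by rw [h0 p hp, zero_smul]
  · rw [eq_top_iff]
    have hX : ∀ (p : P) (F : Finset P),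
        Ideal.Quotient.mk I (MvPolynomial.X p * mon F) ∈ LinearMap.range s := by
      intro p F
      by_cases hp : p ∈ F
      · rcases hrel F with hF | hF
        · rw [Ideal.Quotient.eq_zero_iff_mem.2 (I.mul_mem_left _ hF)]
          exact Submodule.zero_mem _
        · obtain ⟨m, hm, hm1, hm0⟩ := hU F hF p hp
          have := hsr F m hm
          rw [Finset.sum_eq_single_of_mem p hp
            (fun q hq hqp => by rw [hm0 q hq hqp, zero_smul]), hm1, one_smul] at this
          refine ⟨- linkRel ι F m, ?_⟩
          rw [map_neg, this, neg_neg]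
      · refine ⟨faceVec ι (insert p F), ?_⟩
        rw [hsv, hmon]
        simp only
        rw [Finset.prod_insert hp]
    have hmul : ∀ (p : P) (x : MvPolynomial P k),
        Ideal.Quotient.mk I x ∈ LinearMap.range s →
        Ideal.Quotient.mk I (x * MvPolynomial.X p) ∈ LinearMap.range s := by
      rintro p x ⟨z, hz⟩
      rw [mul_comm, map_mul, ← hz]
      clear hz
      induction z using Finsupp.induction_linear with
      | zero => simp
      | add f g hf hg => rw [map_add, mul_add]; exact Submodule.add_mem _ hf hg
      | single g a =>
        rw [show Finsupp.single g a = a • Finsupp.single g (1 : k) by simp, map_smul, hs,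
          mul_smul_comm, ← map_mul]
        exact Submodule.smul_mem _ _ (hX p _)
    rintro y -
    obtain ⟨x, rfl⟩ := Ideal.Quotient.mk_surjective y
    induction x using MvPolynomial.induction_on with
    | C a =>
      refine ⟨a • faceVec ι ∅, ?_⟩
      rw [map_smul, hsv, hmon]
      simp only [Finset.prod_empty]
      rw [← mul_one (MvPolynomial.C a), ← MvPolynomial.smul_eq_C_mul]
      rfl
    | add x y hx hy => rw [map_add]; exact Submodule.add_mem _ hx hy
    | mul_X x p hx => exact hmul p x hx

end FlagComplex

section Partitions

variable {γ : Type*}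

lemma IsTwoPartition.eq_pair {σ : Set (Set γ)} (h : IsTwoPartition σ) {A : Set γ} (hA : A ∈ σ) :
    σ = {A, Aᶜ} := by
  obtain ⟨X, Y, rfl, -, -, -, hd, hu⟩ := h
  have hY : Y = Xᶜ := (IsCompl.compl_eq ⟨hd, codisjoint_iff.2 hu⟩).symm
  subst hY
  rcases hA with rfl | rfl
  · rfl
  · rw [compl_compl, Set.pair_comm]

lemma isTwoPartition_pair {A : Set γ} (h : A.Nonempty) (h' : Aᶜ.Nonempty) :
    IsTwoPartition ({A, Aᶜ} : Set (Set γ)) := by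
  refine ⟨A, Aᶜ, rfl, ?_, h, h', disjoint_compl_right, Set.union_compl_self A⟩
  obtain ⟨x, hx⟩ := h
  intro h
  exact (h ▸ hx : x ∈ Aᶜ) hx

lemma splitsPair_pair_iff (A : Set γ) (a b c d : γ) :
    SplitsPair {A, Aᶜ} a b c d ↔
      (a ∈ A ∧ b ∈ A ∧ c ∉ A ∧ d ∉ A) ∨ (a ∉ A ∧ b ∉ A ∧ c ∈ A ∧ d ∈ A) := by
  constructor
  · rintro ⟨X, hX, Y, hY, hne, h1, h2, h3, h4⟩
    rcases hX with rfl | rfl <;> rcases hY with rfl | rfl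
    · exact absurd rfl hne
    · exact Or.inl ⟨h1, h2, h3, h4⟩
    · exact Or.inr ⟨h1, h2, h3, h4⟩
    · exact absurd rfl hne
  · rintro (⟨h1, h2, h3, h4⟩ | ⟨h1, h2, h3, h4⟩)
    · exact ⟨A, by simp, Aᶜ, by simp, fun h => (h ▸ h1 : a ∈ Aᶜ) h1, h1, h2, h3, h4⟩
    · exact ⟨Aᶜ, by simp, A, by simp, fun h => h1 (h ▸ h1 : a ∈ A), h1, h2, h3, h4⟩

/-- The integer indicator function of a set. -/
def chi (A : Set γ) (x : γ) : ℤ := if x ∈ A then 1 else 0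

lemma eps_pair (A : Set γ) (i j k l : γ) :
    eps {A, Aᶜ} i j k l = (chi A i - chi A k) * (chi A j - chi A l) := by
  simp only [eps, splitsPair_pair_iff, chi]
  by_cases hi : i ∈ A <;> by_cases hj : j ∈ A <;> by_cases hk : k ∈ A <;> by_cases hl : l ∈ A <;>
    simp [hi, hj, hk, hl]

/-- The four intersections of the parts of `{A, Aᶜ}` and `{B, Bᶜ}` are nonempty. -/
def Crossing (A B : Set γ) : Prop :=
  (∃ x, x ∈ A ∧ x ∈ B) ∧ (∃ x, x ∈ A ∧ x ∉ B) ∧ (∃ x, x ∉ A ∧ x ∈ B) ∧ ∃ x, x ∉ A ∧ x ∉ B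

lemma delta_eq_one_of_ssubset {A B : Set γ} (hA : A.Nonempty) (hB : Bᶜ.Nonempty) (h : A ⊂ B) :
    delta {A, Aᶜ} {B, Bᶜ} = 1 := by
  have hset : {X : Set γ | X.Nonempty ∧ ∃ Y ∈ ({A, Aᶜ} : Set (Set γ)),
      ∃ Z ∈ ({B, Bᶜ} : Set (Set γ)), X = Y ∩ Z} = {A, B \ A, Bᶜ} := by
    have h1 : A ∩ B = A := Set.inter_eq_left.2 h.1
    have h2 : A ∩ Bᶜ = ∅ := by rw [← Set.sdiff_eq, Set.sdiff_eq_empty.2 h.1]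
    have h3 : Aᶜ ∩ B = B \ A := by rw [Set.inter_comm, Set.sdiff_eq]
    have h4 : Aᶜ ∩ Bᶜ = Bᶜ := Set.inter_eq_right.2 (Set.compl_subset_compl.2 h.1)
    ext X
    simp only [Set.mem_ofPred_eq, Set.mem_insert_iff, Set.mem_singleton_iff, exists_eq_or_imp,
      exists_eq_left, h1, h2, h3, h4]
    constructor
    · rintro ⟨hX, (rfl | rfl) | rfl | rfl⟩
      · simp
      · exact absurd hX Set.not_nonempty_empty
      · simp
      · simp
    · rintro (rfl | rfl | rfl)
      · exact ⟨hA, by simp⟩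
      · exact ⟨Set.nonempty_of_ssubset h, by simp⟩
      · exact ⟨hB, by simp⟩
  obtain ⟨x, hx⟩ := hA
  obtain ⟨y, hy⟩ := hB
  obtain ⟨z, hz⟩ := Set.nonempty_of_ssubset h
  rw [delta, hset, Set.ncard_insert_of_notMem, Set.ncard_pair]
  · norm_num
  · intro hh; exact (hh ▸ hz : z ∈ Bᶜ) hz.1
  · rintro (hh | hh)
    · exact (hh ▸ hx : x ∈ B \ A).2 hx
    · exact (hh ▸ hx : x ∈ Bᶜ) (h.1 hx)

lemma delta_of_crossing {A B : Set γ} (h : Crossing A B) : delta {A, Aᶜ} {B, Bᶜ} = 2 := by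
  obtain ⟨⟨x, hxA, hxB⟩, ⟨y, hyA, hyB⟩, ⟨z, hzA, hzB⟩, ⟨w, hwA, hwB⟩⟩ := h
  have hset : {X : Set γ | X.Nonempty ∧ ∃ Y ∈ ({A, Aᶜ} : Set (Set γ)),
      ∃ Z ∈ ({B, Bᶜ} : Set (Set γ)), X = Y ∩ Z} = {A ∩ B, A ∩ Bᶜ, Aᶜ ∩ B, Aᶜ ∩ Bᶜ} := by
    ext X
    simp only [Set.mem_ofPred_eq, Set.mem_insert_iff, Set.mem_singleton_iff, exists_eq_or_imp,
      exists_eq_left]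
    constructor
    · rintro ⟨hX, (rfl | rfl) | rfl | rfl⟩ <;> simp
    · rintro (rfl | rfl | rfl | rfl)
      · exact ⟨⟨x, hxA, hxB⟩, by simp⟩
      · exact ⟨⟨y, hyA, hyB⟩, by simp⟩
      · exact ⟨⟨z, hzA, hzB⟩, by simp⟩
      · exact ⟨⟨w, hwA, hwB⟩, by simp⟩
  rw [delta, hset, Set.ncard_insert_of_notMem, Set.ncard_insert_of_notMem, Set.ncard_pair]
  · norm_num
  · intro hh; exact (hh ▸ ⟨hzA, hzB⟩ : z ∈ Aᶜ ∩ Bᶜ).2 hzB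
  · rintro (hh | hh)
    · exact (hh ▸ ⟨hyA, hyB⟩ : y ∈ Aᶜ ∩ B).1 hyA
    · exact (hh ▸ ⟨hyA, hyB⟩ : y ∈ Aᶜ ∩ Bᶜ).1 hyA
  · rintro (hh | hh | hh)
    · exact (hh ▸ ⟨hxA, hxB⟩ : x ∈ A ∩ Bᶜ).2 hxB
    · exact (hh ▸ ⟨hxA, hxB⟩ : x ∈ Aᶜ ∩ B).1 hxA
    · exact (hh ▸ ⟨hxA, hxB⟩ : x ∈ Aᶜ ∩ Bᶜ).1 hxA

lemma delta_eq_one_iff {A B : Set γ} (hA : A.Nonempty) (hA' : Aᶜ.Nonempty) (hB : B.Nonempty)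
    (hB' : Bᶜ.Nonempty) (hne : ({A, Aᶜ} : Set (Set γ)) ≠ {B, Bᶜ}) :
    delta {A, Aᶜ} {B, Bᶜ} = 1 ↔ ¬ Crossing A B := by
  constructor
  · intro h hc
    rw [delta_of_crossing hc] at h
    norm_num at h
  · intro h
    have hne1 : A ≠ B := fun h => hne (by rw [h])
    have hne2 : A ≠ Bᶜ := fun h => hne (by rw [h, compl_compl, Set.pair_comm])
    have key : A ⊆ B ∨ A ⊆ Bᶜ ∨ B ⊆ A ∨ Bᶜ ⊆ A := by
      by_contra hcon
      simp only [not_or, Set.not_subset] at hcon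
      obtain ⟨⟨a, ha⟩, ⟨b, hb⟩, ⟨c, hc⟩, ⟨d, hd⟩⟩ := hcon
      exact h ⟨⟨b, hb.1, not_not.1 hb.2⟩, ⟨a, ha⟩, ⟨c, hc.2, hc.1⟩, ⟨d, hd.2, hd.1⟩⟩
    rcases key with h | h | h | h
    · exact delta_eq_one_of_ssubset hA hB' (h.ssubset_of_ne hne1)
    · rw [Set.pair_comm B]
      have := delta_eq_one_of_ssubset hA (by rwa [compl_compl]) (h.ssubset_of_ne hne2)
      rwa [compl_compl] at this
    · rw [Set.pair_comm A, Set.pair_comm B]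
      have := delta_eq_one_of_ssubset hA' (by rwa [compl_compl])
        ((Set.compl_subset_compl.2 h).ssubset_of_ne fun h => hne1 (compl_injective h))
      rwa [compl_compl, compl_compl] at this
    · rw [Set.pair_comm A]
      have := delta_eq_one_of_ssubset hA' hB' ((Set.compl_subset_comm.1 h).ssubset_of_ne
        fun h => hne2 (by rw [← h, compl_compl]))
      rwa [compl_compl] at this

lemma PaintedStablePart.eq_pair {W : Set γ} {σ : Set (Set γ)} (h : PaintedStablePart W σ)
    {A : Set γ} (hA : A ∈ σ) : σ = {A, Aᶜ} := h.1.eq_pair hA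

lemma PaintedStablePart.exists_eq {W : Set γ} {σ : Set (Set γ)} (h : PaintedStablePart W σ) :
    ∃ A, σ = {A, Aᶜ} := by
  obtain ⟨A, B, hσ, -⟩ := h.1
  exact ⟨A, h.eq_pair (by rw [hσ]; simp)⟩

lemma PaintedStablePart.exists_eq_mem {W : Set γ} {σ : Set (Set γ)} (h : PaintedStablePart W σ)
    (i : γ) : ∃ A, σ = {A, Aᶜ} ∧ i ∈ A := by
  obtain ⟨A, rfl⟩ := h.exists_eq
  by_cases hi : i ∈ A
  · exact ⟨A, rfl, hi⟩
  · exact ⟨Aᶜ, by rw [compl_compl, Set.pair_comm], hi⟩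

lemma paintedStablePart_pair_iff {W : Set γ} {A : Set γ} :
    PaintedStablePart W {A, Aᶜ} ↔
      ((A ∩ W).Nonempty ∧ 2 ≤ A.ncard) ∧ (Aᶜ ∩ W).Nonempty ∧ 2 ≤ Aᶜ.ncard := by
  constructor
  · intro h
    exact ⟨h.2 A (by simp), h.2 Aᶜ (by simp)⟩
  · rintro ⟨h1, h2⟩
    refine ⟨isTwoPartition_pair (h1.1.mono Set.inter_subset_left)
      (h2.1.mono Set.inter_subset_left), ?_⟩
    rintro X (rfl | rfl)
    · exact h1
    · exact h2

lemma delta_eq_one_iff_of_painted {W A B : Set γ} (hA : PaintedStablePart W {A, Aᶜ})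
    (hB : PaintedStablePart W {B, Bᶜ}) (hne : ({A, Aᶜ} : Set (Set γ)) ≠ {B, Bᶜ}) :
    delta {A, Aᶜ} {B, Bᶜ} = 1 ↔ ¬ Crossing A B := by
  rw [paintedStablePart_pair_iff] at hA hB
  exact delta_eq_one_iff (hA.1.1.mono Set.inter_subset_left) (hA.2.1.mono Set.inter_subset_left)
    (hB.1.1.mono Set.inter_subset_left) (hB.2.1.mono Set.inter_subset_left) hne

end Partitions

section GoodFamilies

variable {γ : Type} {W : Set γ}

/-- Two painted stable partitions are compatible. -/
def PSCompat (γ : Type) (W : Set γ) (p q : PSP γ W) : Prop := delta p.1 q.1 = 1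

/-- The linear form of a quadruple. -/
def epsForm (W : Set γ) (k : Type) [CommRing k] (i j a b : γ) : PSP γ W → k :=
  fun p => (eps p.1 i j a b : ℤ)

/-- The span of the linear forms of the allowed quadruples. -/
def epsSpan (W : Set γ) (k : Type) [CommRing k] : Submodule k (PSP γ W → k) :=
  Submodule.span k {l | ∃ i j a b, Allowed W i j a b ∧ l = epsForm W k i j a b}

/-- The span of the linear forms of the allowed quadruples not split by any element of `F`. -/
def unsplitSpan (W : Set γ) (k : Type) [CommRing k] (F : Finset (PSP γ W)) :
    Submodule k (PSP γ W → k) :=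
  Submodule.span k {l | ∃ i j a b, Allowed W i j a b ∧ (∀ p ∈ F, eps p.1 i j a b = 0) ∧
    l = epsForm W k i j a b}

lemma not_crossing_of_isFace {F : Finset (PSP γ W)} (hF : IsFace (PSCompat γ W) F)
    {p q : PSP γ W} (hp : p ∈ F) (hq : q ∈ F) {A B : Set γ} (hA : A ∈ p.1) (hB : B ∈ q.1)
    (hne : p ≠ q) : ¬ Crossing A B := by
  have h := hF p hp q hq hne
  have hA' := p.2.eq_pair hA
  have hB' := q.2.eq_pair hB
  rw [PSCompat, hA', hB'] at h
  refine (delta_eq_one_iff_of_painted (hA' ▸ p.2) (hB' ▸ q.2) ?_).1 h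
  rw [← hA', ← hB']
  exact fun h => hne (Subtype.ext h)

/-- The elements `i` and `j` are equal or lie in a common part contained in `A`. -/
def SameBranch (F : Finset (PSP γ W)) (A : Set γ) (i j : γ) : Prop :=
  i = j ∨ ∃ q ∈ F, ∃ D ∈ q.1, D ⊆ A ∧ i ∈ D ∧ j ∈ D

lemma SameBranch.symm {F : Finset (PSP γ W)} {A : Set γ} {i j : γ} (h : SameBranch F A i j) :
    SameBranch F A j i := by
  rcases h with rfl | ⟨q, hq, D, hD, hDA, hi, hj⟩
  · exact Or.inl rfl
  · exact Or.inr ⟨q, hq, D, hD, hDA, hj, hi⟩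

lemma part_nested {F : Finset (PSP γ W)} (hF : IsFace (PSCompat γ W) F) {A : Set γ}
    (hA : Aᶜ.Nonempty) {q q' : PSP γ W} (hq : q ∈ F) (hq' : q' ∈ F) {D D' : Set γ}
    (hD : D ∈ q.1) (hD' : D' ∈ q'.1) (hDA : D ⊆ A) (hDA' : D' ⊆ A) {j : γ} (hj : j ∈ D)
    (hj' : j ∈ D') : D ⊆ D' ∨ D' ⊆ D := by
  by_cases hqq : q = q'
  · subst hqq
    rw [q.2.eq_pair hD] at hD'
    rcases hD' with rfl | rfl
    · exact Or.inl subset_rfl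
    · exact absurd hj hj'
  · by_contra hcon
    simp only [not_or, Set.not_subset] at hcon
    obtain ⟨⟨a, ha⟩, ⟨b, hb⟩⟩ := hcon
    obtain ⟨w, hw⟩ := hA
    exact not_crossing_of_isFace hF hq hq' hD hD' hqq
      ⟨⟨j, hj, hj'⟩, ⟨a, ha⟩, ⟨b, hb.2, hb.1⟩, ⟨w, fun h => hw (hDA h), fun h => hw (hDA' h)⟩⟩

lemma SameBranch.trans {F : Finset (PSP γ W)} (hF : IsFace (PSCompat γ W) F) {A : Set γ}
    (hA : Aᶜ.Nonempty) {i j l : γ} (h : SameBranch F A i j) (h' : SameBranch F A j l) :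
    SameBranch F A i l := by
  rcases h with rfl | ⟨q, hq, D, hD, hDA, hi, hj⟩
  · exact h'
  rcases h' with rfl | ⟨q', hq', D', hD', hDA', hj', hl⟩
  · exact Or.inr ⟨q, hq, D, hD, hDA, hi, hj⟩
  rcases part_nested hF hA hq hq' hD hD' hDA hDA' hj hj' with h | h
  · exact Or.inr ⟨q', hq', D', hD', hDA', h hi, hl⟩
  · exact Or.inr ⟨q, hq, D, hD, hDA, hi, h hl⟩

lemma exists_not_sameBranch [Finite γ] {F : Finset (PSP γ W)} (hF : IsFace (PSCompat γ W) F)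
    {A : Set γ} (hA : Aᶜ.Nonempty) (h2 : 2 ≤ A.ncard) (hAF : ∀ q ∈ F, A ∉ q.1) (i : γ) :
    ∃ j ∈ A, ¬ SameBranch F A i j := by
  by_contra! hcon
  have hne : {D : Set γ | ∃ q ∈ F, D ∈ q.1 ∧ D ⊆ A ∧ i ∈ D}.Nonempty := by
    obtain ⟨j, hj, hji⟩ := Set.exists_ne_of_one_lt_ncard h2 i
    rcases hcon j hj with rfl | ⟨q, hq, D, hD, hDA, hi', hj⟩
    · exact absurd rfl hji
    · exact ⟨D, q, hq, hD, hDA, hi'⟩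
  obtain ⟨D, ⟨q, hq, hD, hDA, hiD⟩, hmax⟩ := Set.Finite.exists_maximal (Set.toFinite _) hne
  have hex : ∃ j ∈ A, j ∉ D := by
    by_contra! h
    exact hAF q hq (Set.Subset.antisymm hDA h ▸ hD)
  obtain ⟨j, hj, hjD⟩ := hex
  rcases hcon j hj with rfl | ⟨q', hq', D', hD', hDA', hi', hj'⟩
  · exact hjD hiD
  · rcases part_nested hF hA hq hq' hD hD' hDA hDA' hiD hi' with h | h
    · exact hjD (hmax ⟨q', hq', hD', hDA', hi'⟩ h hj')
    · exact hjD (h hj')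

lemma eps_pair_eq_zero_iff {A : Set γ} {i j k l : γ} :
    eps {A, Aᶜ} i j k l = 0 ↔
      ¬ (i ∈ A ∧ j ∈ A ∧ k ∉ A ∧ l ∉ A) ∧ ¬ (i ∉ A ∧ j ∉ A ∧ k ∈ A ∧ l ∈ A) ∧
      ¬ (k ∈ A ∧ j ∈ A ∧ i ∉ A ∧ l ∉ A) ∧ ¬ (k ∉ A ∧ j ∉ A ∧ i ∈ A ∧ l ∈ A) := by
  rw [eps_pair]
  simp only [chi]
  by_cases hi : i ∈ A <;> by_cases hj : j ∈ A <;> by_cases hk : k ∈ A <;> by_cases hl : l ∈ A <;>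
    simp [hi, hj, hk, hl]

lemma eps_eq_zero_of_not_sameBranch {F : Finset (PSP γ W)} {p : PSP γ W} (hpF : p ∉ F)
    (hF : IsFace (PSCompat γ W) (insert p F)) {A : Set γ} (hA : A ∈ p.1) {i j k l : γ}
    (hi : i ∈ A) (hj : j ∈ A) (hk : k ∉ A) (hl : l ∉ A) (h1 : ¬ SameBranch F A i j)
    (h2 : ¬ SameBranch F Aᶜ k l) (q : PSP γ W) (hq : q ∈ F) : eps q.1 i j k l = 0 := by
  have hpq : q ≠ p := fun h => hpF (h ▸ hq)
  obtain ⟨D, hqD, hjD⟩ := q.2.exists_eq_mem j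
  have hD : D ∈ q.1 := by rw [hqD]; simp
  have hD' : Dᶜ ∈ q.1 := by rw [hqD]; simp
  have hc := not_crossing_of_isFace hF (Finset.mem_insert_of_mem hq)
    (Finset.mem_insert_self p F) hD hA hpq
  rw [hqD, eps_pair_eq_zero_iff]
  refine ⟨fun ⟨hiD, _, hkD, hlD⟩ => ?_, fun h => h.2.1 hjD, fun ⟨hkD, _, hiD, hlD⟩ => ?_,
    fun h => h.2.1 hjD⟩
  · by_cases hs : D ⊆ A
    · exact h1 (Or.inr ⟨q, hq, D, hD, hs, hiD, hjD⟩)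
    · obtain ⟨x, hx⟩ := Set.not_subset.1 hs
      refine h2 (Or.inr ⟨q, hq, Dᶜ, hD', fun y hy hyA => ?_, hkD, hlD⟩)
      exact hc ⟨⟨i, hiD, hi⟩, ⟨x, hx⟩, ⟨y, hy, hyA⟩, ⟨k, hkD, hk⟩⟩
  · exact hc ⟨⟨j, hjD, hj⟩, ⟨k, hkD, hk⟩, ⟨i, hiD, hi⟩, ⟨l, hlD, hl⟩⟩

lemma not_sameBranch_of_eps_eq_zero {F : Finset (PSP γ W)} {A : Set γ} {i j k l : γ}
    (hij : i ≠ j) (hk : k ∉ A) (hl : l ∉ A) (h : ∀ q ∈ F, eps q.1 i j k l = 0) :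
    ¬ SameBranch F A i j := by
  rintro (rfl | ⟨q, hq, D, hD, hDA, hi, hj⟩)
  · exact hij rfl
  · have := h q hq
    rw [q.2.eq_pair hD, eps_pair_eq_zero_iff] at this
    exact this.1 ⟨hi, hj, fun h => hk (hDA h), fun h => hl (hDA h)⟩

lemma eps_eq_chi {p : PSP γ W} {A : Set γ} (hA : A ∈ p.1) (i j k l : γ) :
    eps p.1 i j k l = (chi A i - chi A k) * (chi A j - chi A l) := by
  rw [p.2.eq_pair hA, eps_pair]

lemma eps_eq_chi' (p : PSP γ W) : ∃ A : Set γ, ∀ i j k l : γ,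
    eps p.1 i j k l = (chi A i - chi A k) * (chi A j - chi A l) := by
  obtain ⟨A, hA⟩ := p.2.exists_eq
  exact ⟨A, fun i j k l => eps_eq_chi (by rw [hA]; simp) i j k l⟩

lemma eps_swap (p : PSP γ W) (i j k l : γ) : eps p.1 j i l k = eps p.1 i j k l := by
  obtain ⟨A, h⟩ := eps_eq_chi' p
  rw [h, h]; ring

lemma eps_exchange (p : PSP γ W) (i j k l : γ) : eps p.1 k l i j = eps p.1 i j k l := by
  obtain ⟨A, h⟩ := eps_eq_chi' p
  rw [h, h]; ring

lemma eps_neg (p : PSP γ W) (i j k l : γ) : eps p.1 k j i l = - eps p.1 i j k l := by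
  obtain ⟨A, h⟩ := eps_eq_chi' p
  rw [h, h]; ring

lemma eps_sub_left (p : PSP γ W) (i i' j k l : γ) :
    eps p.1 i j k l - eps p.1 i' j k l = eps p.1 i j i' l := by
  obtain ⟨A, h⟩ := eps_eq_chi' p
  rw [h, h, h]; ring

lemma eps_sub_right (p : PSP γ W) (i j j' k l : γ) :
    eps p.1 i j k l - eps p.1 i j' k l = eps p.1 i j k j' := by
  obtain ⟨A, h⟩ := eps_eq_chi' p
  rw [h, h, h]; ring

lemma eps_sub_swap (p : PSP γ W) (i j k l : γ) :
    eps p.1 i j k l - eps p.1 j i k l = eps p.1 i k j l := by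
  obtain ⟨A, h⟩ := eps_eq_chi' p
  rw [h, h, h]; ring

variable (k : Type) [CommRing k]

lemma sub_mem_unsplitSpan {F : Finset (PSP γ W)} {i j a b i' j' a' b' i'' j'' a'' b'' : γ}
    (hal : Allowed W i'' j'' a'' b'')
    (hsub : ∀ p : PSP γ W, eps p.1 i j a b - eps p.1 i' j' a' b' = eps p.1 i'' j'' a'' b'')
    (heq : ∀ p ∈ F, eps p.1 i j a b = eps p.1 i' j' a' b') :
    epsForm W k i j a b - epsForm W k i' j' a' b' ∈ unsplitSpan W k F := by
  refine Submodule.subset_span ⟨i'', j'', a'', b'', hal, fun p hp => ?_, ?_⟩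
  · rw [← hsub p, heq p hp, sub_self]
  · ext p
    simp [epsForm, ← hsub p]

lemma epsForm_sub_mem_of_white {F : Finset (PSP γ W)} {p : PSP γ W} (hpF : p ∉ F)
    (hF : IsFace (PSCompat γ W) (insert p F)) {A : Set γ} (hA : A ∈ p.1)
    {i j i' j' a b : γ} (hi : i ∈ A) (hj : j ∈ A) (hi' : i' ∈ A) (hj' : j' ∈ A)
    (ha : a ∉ A) (hb : b ∉ A) (hiW : i ∈ W) (hiW' : i' ∈ W) (haW : a ∈ W)
    (hij : ¬ SameBranch F A i j) (hij' : ¬ SameBranch F A i' j')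
    (hab : ¬ SameBranch F Aᶜ a b) :
    epsForm W k i j a b - epsForm W k i' j' a b ∈ unsplitSpan W k (insert p F) := by
  have hAc : Aᶜ.Nonempty := ⟨a, ha⟩
  have hne : ∀ {x y}, x ∈ A → y ∉ A → x ≠ y := fun hx hy h => hy (h ▸ hx)
  have nsb : ∀ {x y}, ¬ SameBranch F A x y → x ≠ y := fun h h' => h (Or.inl h')
  have habne : a ≠ b := fun h => hab (Or.inl h)
  have heq : ∀ {x y x' y' : γ}, x ∈ A → y ∈ A → x' ∈ A → y' ∈ A → ¬ SameBranch F A x y →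
      ¬ SameBranch F A x' y' →
      ∀ q ∈ insert p F, eps q.1 x y a b = eps q.1 x' y' a b := by
    intro x y x' y' hx hy hx' hy' h h' q hq
    rcases Finset.mem_insert.1 hq with rfl | hq
    · rw [eps_eq_chi hA, eps_eq_chi hA]
      simp [chi, hx, hy, hx', hy', ha, hb]
    · rw [eps_eq_zero_of_not_sameBranch hpF hF hA hx hy ha hb h hab q hq,
        eps_eq_zero_of_not_sameBranch hpF hF hA hx' hy' ha hb h' hab q hq]
  have left : ∀ {x x' y : γ}, x ∈ A → y ∈ A → x' ∈ A → x ∈ W → x' ∈ W → ¬ SameBranch F A x y →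
      ¬ SameBranch F A x' y →
      epsForm W k x y a b - epsForm W k x' y a b ∈ unsplitSpan W k (insert p F) := by
    intro x x' y hx hy hx' hxW hxW' h h'
    by_cases hxx : x = x'
    · subst hxx; rw [sub_self]; exact Submodule.zero_mem _
    · exact sub_mem_unsplitSpan k ⟨nsb h, hxx, hne hx hb, (nsb h').symm, hne hy hb, hne hx' hb,
        Or.inl hxW, Or.inl hxW', Or.inl hxW', Or.inl hxW⟩
        (fun p => eps_sub_left p x x' y a b) (heq hx hy hx' hy h h')
  have right : ∀ {x y y' : γ}, x ∈ A → y ∈ A → y' ∈ A → x ∈ W → ¬ SameBranch F A x y →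
      ¬ SameBranch F A x y' →
      epsForm W k x y a b - epsForm W k x y' a b ∈ unsplitSpan W k (insert p F) := by
    intro x y y' hx hy hy' hxW h h'
    by_cases hyy : y = y'
    · subst hyy; rw [sub_self]; exact Submodule.zero_mem _
    · exact sub_mem_unsplitSpan k ⟨nsb h, hne hx ha, nsb h', hne hy ha, hyy, (hne hy' ha).symm,
        Or.inl hxW, Or.inl haW, Or.inl haW, Or.inl hxW⟩
        (fun p => eps_sub_right p x y y' a b) (heq hx hy hx hy' h h')
  have swap : ∀ {x y : γ}, x ∈ A → y ∈ A → x ∈ W → y ∈ W → ¬ SameBranch F A x y →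
      epsForm W k x y a b - epsForm W k y x a b ∈ unsplitSpan W k (insert p F) := by
    intro x y hx hy hxW hyW h
    exact sub_mem_unsplitSpan k ⟨hne hx ha, nsb h, hne hx hb, (hne hy ha).symm, habne, hne hy hb,
        Or.inl hxW, Or.inl hyW, Or.inl hyW, Or.inl hxW⟩
        (fun p => eps_sub_swap p x y a b)
        (heq hx hy hy hx h fun h' => h h'.symm)
  by_cases h1 : SameBranch F A i' j
  · have h2 : ¬ SameBranch F A i i' := fun h =>
      hij (h.trans (hF.mono (Finset.subset_insert p F)) hAc h1)
    have := Submodule.add_mem _ (Submodule.add_mem _ (right hi hj hi' hiW hij h2)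
      (swap hi hi' hiW hiW' h2)) (right hi' hi hj' hiW' (fun h => h2 h.symm) hij')
    simpa using this
  · have := Submodule.add_mem _ (left hi hj hi' hiW hiW' hij h1) (right hi' hj hj' hiW' h1 hij')
    simpa using this

lemma Allowed.white {i j a b : γ} (h : Allowed W i j a b) :
    (i ∈ W ∧ a ∈ W) ∨ (j ∈ W ∧ b ∈ W) := by
  obtain ⟨-, -, -, -, -, -, h1, h2, h3, h4⟩ := h
  tauto

lemma epsForm_swap (i j a b : γ) : epsForm W k j i b a = epsForm W k i j a b := by
  ext p; simp only [epsForm, eps_swap]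

lemma epsForm_exchange (i j a b : γ) : epsForm W k a b i j = epsForm W k i j a b := by
  ext p; simp only [epsForm, eps_exchange]

lemma epsForm_neg (i j a b : γ) : epsForm W k a j i b = - epsForm W k i j a b := by
  ext p; simp only [epsForm, Pi.neg_apply]; rw [eps_neg p i j a b]; simp

lemma epsForm_sub_mem {F : Finset (PSP γ W)} {p : PSP γ W} (hpF : p ∉ F)
    (hF : IsFace (PSCompat γ W) (insert p F)) {A : Set γ} (hA : A ∈ p.1)
    {i j a b i' j' a' b' : γ} (hi : i ∈ A) (hj : j ∈ A) (ha : a ∉ A) (hb : b ∉ A)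
    (hi' : i' ∈ A) (hj' : j' ∈ A) (ha' : a' ∉ A) (hb' : b' ∉ A)
    (hal : Allowed W i j a b) (hal' : Allowed W i' j' a' b')
    (h : ∀ q ∈ F, eps q.1 i j a b = 0) (h' : ∀ q ∈ F, eps q.1 i' j' a' b' = 0) :
    epsForm W k i j a b - epsForm W k i' j' a' b' ∈ unsplitSpan W k (insert p F) := by
  wlog hw : i ∈ W ∧ a ∈ W generalizing i j a b
  · rw [← epsForm_swap]
    have hw' := hal.white.resolve_left hw
    obtain ⟨h1, h2, h3, h4, h5, h6, h7, h8, h9, h10⟩ := hal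
    exact this hj hi hb ha ⟨h1.symm, h5, h4, h3, h2, h6.symm, h7.symm, h8.symm, h10.symm,
      h9.symm⟩ (fun q hq => by rw [eps_swap, h q hq]) hw'
  wlog hw' : i' ∈ W ∧ a' ∈ W generalizing i' j' a' b'
  · rw [← epsForm_swap k i' j' a' b']
    have hw'' := hal'.white.resolve_left hw'
    obtain ⟨h1, h2, h3, h4, h5, h6, h7, h8, h9, h10⟩ := hal'
    exact this hj' hi' hb' ha' ⟨h1.symm, h5, h4, h3, h2, h6.symm, h7.symm, h8.symm, h10.symm,
      h9.symm⟩ (fun q hq => by rw [eps_swap, h' q hq]) hw''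
  have hA' : Aᶜ ∈ p.1 := by rw [p.2.eq_pair hA]; simp
  have n1 := not_sameBranch_of_eps_eq_zero hal.1 ha hb h
  have n1' := not_sameBranch_of_eps_eq_zero hal'.1 ha' hb' h'
  have n2 : ¬ SameBranch F Aᶜ a b := not_sameBranch_of_eps_eq_zero hal.2.2.2.2.2.1
    (not_not.2 hi) (not_not.2 hj) fun q hq => by rw [eps_exchange, h q hq]
  have n2' : ¬ SameBranch F Aᶜ a' b' := not_sameBranch_of_eps_eq_zero hal'.2.2.2.2.2.1
    (not_not.2 hi') (not_not.2 hj') fun q hq => by rw [eps_exchange, h' q hq]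
  have s1 := epsForm_sub_mem_of_white k hpF hF hA hi hj hi' hj' ha hb hw.1 hw'.1 hw.2 n1 n1' n2
  have s2 := epsForm_sub_mem_of_white k hpF hF hA' (i := a) (j := b) (i' := a') (j' := b')
    (a := i') (b := j') ha hb ha' hb' (not_not.2 hi') (not_not.2 hj') hw.2 hw'.2 hw'.1 n2 n2'
    (by rwa [compl_compl])
  rw [epsForm_exchange k i' j' a b, epsForm_exchange k i' j' a' b'] at s2
  simpa using Submodule.add_mem _ s1 s2

lemma exists_allowed_split [Finite γ] {F : Finset (PSP γ W)} {p : PSP γ W} (hpF : p ∉ F)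
    (hF : IsFace (PSCompat γ W) (insert p F)) {A : Set γ} (hA : A ∈ p.1) :
    ∃ i ∈ A, ∃ j ∈ A, ∃ a ∉ A, ∃ b ∉ A, Allowed W i j a b ∧ ∀ q ∈ F, eps q.1 i j a b = 0 := by
  have hp := p.2
  rw [p.2.eq_pair hA, paintedStablePart_pair_iff] at hp
  obtain ⟨⟨⟨i, hi, hiW⟩, h2⟩, ⟨a, ha, haW⟩, h2'⟩ := hp
  have hF' := hF.mono (Finset.subset_insert p F)
  have hno : ∀ B : Set γ, B ∈ p.1 → ∀ q ∈ F, B ∉ q.1 := by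
    intro B hB q hq hBq
    refine hpF ?_
    have : p = q := Subtype.ext ((p.2.eq_pair hB).trans (q.2.eq_pair hBq).symm)
    rwa [this]
  obtain ⟨j, hj, hij⟩ := exists_not_sameBranch hF' ⟨a, ha⟩ h2 (hno A hA) i
  obtain ⟨b, hb, hab⟩ := exists_not_sameBranch hF' (A := Aᶜ) ⟨i, not_not.2 hi⟩ h2'
    (hno _ (by rw [p.2.eq_pair hA]; simp)) a
  have hne : ∀ {x y}, x ∈ A → y ∉ A → x ≠ y := fun hx hy h => hy (h ▸ hx)
  exact ⟨i, hi, j, hj, a, ha, b, hb, ⟨fun h => hij (Or.inl h), hne hi ha, hne hi hb, hne hj ha,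
    hne hj hb, fun h => hab (Or.inl h), Or.inl hiW, Or.inl haW, Or.inl haW, Or.inl hiW⟩,
    eps_eq_zero_of_not_sameBranch hpF hF hA hi hj ha hb hij hab⟩

lemma eps_eq_one {p : PSP γ W} {A : Set γ} (hA : A ∈ p.1) {i j a b : γ} (hi : i ∈ A)
    (hj : j ∈ A) (ha : a ∉ A) (hb : b ∉ A) : eps p.1 i j a b = 1 := by
  rw [eps_eq_chi hA]
  simp [chi, hi, hj, ha, hb]

lemma unimodular_epsSpan [Finite γ] : Unimodular (PSCompat γ W) (epsSpan W k) := by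
  intro F hF p hp
  obtain ⟨A, hA⟩ := p.2.exists_eq
  have hA : A ∈ p.1 := by rw [hA]; simp
  rw [← Finset.insert_erase hp] at hF
  obtain ⟨i, hi, j, hj, a, ha, b, hb, hal, h0⟩ :=
    exists_allowed_split (Finset.notMem_erase p F) hF hA
  refine ⟨epsForm W k i j a b, Submodule.subset_span ⟨i, j, a, b, hal, rfl⟩, ?_, ?_⟩
  · simp [epsForm, eps_eq_one hA hi hj ha hb]
  · intro q hq hqp
    simp [epsForm, h0 q (Finset.mem_erase.2 ⟨hqp, hq⟩)]

lemma eps_split_cases (p : PSP γ W) (i j a b : γ) : eps p.1 i j a b = 0 ∨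
    (∃ A ∈ p.1, i ∈ A ∧ j ∈ A ∧ a ∉ A ∧ b ∉ A) ∨ ∃ A ∈ p.1, a ∈ A ∧ j ∈ A ∧ i ∉ A ∧ b ∉ A := by
  obtain ⟨A, hA, hj⟩ := p.2.exists_eq_mem j
  have hAm : A ∈ p.1 := by rw [hA]; simp
  by_cases h : eps p.1 i j a b = 0
  · exact Or.inl h
  · rw [hA, eps_pair_eq_zero_iff] at h
    right
    by_cases hi : i ∈ A
    · exact Or.inl ⟨A, hAm, by tauto⟩
    · exact Or.inr ⟨A, hAm, by tauto⟩

/-- The linear forms in `epsSpan` vanishing on a good family are spanned by the forms of the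
quadruples vanishing on it. -/
theorem mem_unsplitSpan_of_vanish [Finite γ] {F : Finset (PSP γ W)}
    (hF : IsFace (PSCompat γ W) F) {l : PSP γ W → k} (hl : l ∈ epsSpan W k)
    (h0 : ∀ p ∈ F, l p = 0) : l ∈ unsplitSpan W k F := by
  induction F using Finset.induction_on generalizing l with
  | empty =>
    refine Submodule.span_mono ?_ hl
    rintro _ ⟨i, j, a, b, hal, rfl⟩
    exact ⟨i, j, a, b, hal, by simp, rfl⟩
  | insert p F hpF ih =>
    have hl' := ih (hF.mono (Finset.subset_insert p F)) hl
      fun q hq => h0 q (Finset.mem_insert_of_mem hq)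
    obtain ⟨A, hA⟩ := p.2.exists_eq
    have hA : A ∈ p.1 := by rw [hA]; simp
    obtain ⟨i₀, hi₀, j₀, hj₀, a₀, ha₀, b₀, hb₀, hal₀, h₀⟩ := exists_allowed_split hpF hF hA
    have pos : ∀ {i j a b : γ}, Allowed W i j a b → (∀ q ∈ F, eps q.1 i j a b = 0) →
        (∃ B ∈ p.1, i ∈ B ∧ j ∈ B ∧ a ∉ B ∧ b ∉ B) →
        epsForm W k i j a b - epsForm W k i₀ j₀ a₀ b₀ ∈ unsplitSpan W k (insert p F) := by
      rintro i j a b hal h ⟨B, hB, hi, hj, ha, hb⟩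
      rw [p.2.eq_pair hA] at hB
      rcases hB with rfl | rfl
      · exact epsForm_sub_mem k hpF hF hA hi hj ha hb hi₀ hj₀ ha₀ hb₀ hal hal₀ h h₀
      · rw [← epsForm_exchange]
        obtain ⟨h1, h2, h3, h4, h5, h6, h7, h8, h9, h10⟩ := hal
        exact epsForm_sub_mem k hpF hF hA (not_not.1 ha) (not_not.1 hb) hi hj hi₀ hj₀ ha₀ hb₀
          ⟨h6, h2.symm, h4.symm, h3.symm, h5.symm, h1, h8, h7, h10, h9⟩ hal₀
          (fun q hq => by rw [eps_exchange, h q hq]) h₀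
    have key : ∀ x ∈ unsplitSpan W k F,
        x - x p • epsForm W k i₀ j₀ a₀ b₀ ∈ unsplitSpan W k (insert p F) := by
      intro x hx
      induction hx using Submodule.span_induction with
      | mem x hx =>
        obtain ⟨i, j, a, b, hal, h, rfl⟩ := hx
        rcases eps_split_cases p i j a b with hz | hz | hz
        · have : epsForm W k i j a b p = 0 := by simp [epsForm, hz]
          rw [this, zero_smul, sub_zero]
          refine Submodule.subset_span ⟨i, j, a, b, hal, fun q hq => ?_, rfl⟩
          rcases Finset.mem_insert.1 hq with rfl | hq
          exacts [hz, h q hq]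
        · have h1 : epsForm W k i j a b p = 1 := by
            obtain ⟨B, hB, hi, hj, ha, hb⟩ := hz
            simp [epsForm, eps_eq_one hB hi hj ha hb]
          rw [h1, one_smul]
          exact pos hal h hz
        · have h1 : epsForm W k i j a b p = -1 := by
            obtain ⟨B, hB, hi, hj, ha, hb⟩ := hz
            rw [epsForm_neg k a j i b]
            simp [epsForm, eps_eq_one hB hi hj ha hb]
          rw [h1, neg_smul, one_smul, epsForm_neg k a j i b, ← neg_sub']
          obtain ⟨h1, h2, h3, h4, h5, h6, h7, h8, h9, h10⟩ := hal
          have := Submodule.neg_mem _ (pos ⟨h4.symm, h2.symm, h6, h1.symm, h5, h3, h9, h10, h7, h8⟩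
            (fun q hq => by rw [eps_neg, h q hq, neg_zero]) hz)
          simpa using this
      | zero => simp
      | add x y _ _ hx hy =>
        have := Submodule.add_mem _ hx hy
        rw [Pi.add_apply, add_smul]
        convert this using 1
        abel
      | smul c x _ hx =>
        have := Submodule.smul_mem _ c hx
        rwa [smul_sub, smul_smul] at this
    have := key l hl'
    rwa [h0 p (Finset.mem_insert_self _ _), zero_smul, sub_zero] at this

end GoodFamilies

namespace LTree

open Relation

variable {γ : Type} (τ : LTree γ)

lemma sideAdj_symm {f : τ.Fl} {a b : τ.V} (h : τ.sideAdj f a b) : τ.sideAdj f b a := by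
  obtain ⟨g, h1, h2, h3, h4⟩ := h
  refine ⟨τ.inv g, fun h => h2 ?_, fun h => h1 ?_, h4, ?_⟩
  · rw [← h, τ.inv_inv]
  · rw [← τ.inv_inv g, h, τ.inv_inv]
  · rwa [τ.inv_inv]

instance (f : τ.Fl) : Std.Symm (τ.sideAdj f) := ⟨fun _ _ => τ.sideAdj_symm⟩

lemma sideAdj_inv (f : τ.Fl) : τ.sideAdj (τ.inv f) = τ.sideAdj f := by
  ext a b
  simp only [sideAdj, τ.inv_inv]
  constructor <;> rintro ⟨g, h1, h2, h⟩ <;> exact ⟨g, h2, h1, h⟩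

/-- The vertices on the `f`-side of the edge `{f, inv f}`. -/
def vside (f : τ.Fl) : Set τ.V := {v | ReflTransGen (τ.sideAdj f) v (τ.bd f)}

lemma bd_mem_vside (f : τ.Fl) : τ.bd f ∈ τ.vside f := ReflTransGen.refl

lemma mem_flagSide {f : τ.Fl} {s : γ} : s ∈ τ.flagSide f ↔ τ.bd (τ.label s) ∈ τ.vside f :=
  Iff.rfl

lemma bd_mem_vside_iff {f g : τ.Fl} (h : g ≠ f) (h' : g ≠ τ.inv f) :
    τ.bd g ∈ τ.vside f ↔ τ.bd (τ.inv g) ∈ τ.vside f := by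
  have hadj : τ.sideAdj f (τ.bd g) (τ.bd (τ.inv g)) := ⟨g, h, h', rfl, rfl⟩
  exact ⟨fun hg => ReflTransGen.head (τ.sideAdj_symm hadj) hg,
    fun hg => ReflTransGen.head hadj hg⟩

lemma bd_inv_notMem_vside {f : τ.Fl} (hf : τ.inv f ≠ f) : τ.bd (τ.inv f) ∉ τ.vside f := by
  intro hmem
  have hall : ∀ v, v ∈ τ.vside f := by
    intro v
    induction τ.conn v (τ.bd f) using ReflTransGen.head_induction_on with
    | refl => exact τ.bd_mem_vside f
    | head h _ ih =>
      obtain ⟨g, rfl, rfl⟩ := h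
      by_cases h1 : g = f
      · rw [h1]; exact τ.bd_mem_vside f
      by_cases h2 : g = τ.inv f
      · rwa [h2]
      · exact (τ.bd_mem_vside_iff h1 h2).2 ih
  let G : SimpleGraph τ.V :=
    { Adj := fun a b => a ≠ b ∧ τ.sideAdj f a b
      symm := ⟨fun a b h => ⟨h.1.symm, τ.sideAdj_symm h.2⟩⟩
      loopless := ⟨fun a h => h.1 rfl⟩ }
  have hreach : ∀ v, G.Reachable v (τ.bd f) := by
    intro v
    induction hall v using ReflTransGen.head_induction_on with
    | refl => rfl
    | @head a b h _ ih =>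
      by_cases hab : a = b
      · rwa [hab]
      · exact (SimpleGraph.Adj.reachable (G := G) ⟨hab, h⟩).trans ih
  have : Nonempty τ.V := ⟨τ.bd f⟩
  have hconn : G.Connected := ⟨fun a b => (hreach a).trans (hreach b).symm⟩
  have hle := hconn.card_vert_le_card_edgeSet_add_one
  have := Fintype.ofFinite τ.V
  have := Fintype.ofFinite τ.Fl
  have hdart := G.dart_card_eq_twice_card_edges
  have hE : Nat.card G.edgeSet = G.edgeFinset.card := by
    rw [Nat.card_eq_fintype_card, SimpleGraph.edgeFinset_card]
  choose φ hφ1 hφ2 hφ3 hφ4 using fun d : G.Dart => d.adj.2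
  have hinj : Function.Injective fun d : G.Dart => φ d := by
    intro d d' hdd
    have hdd : φ d = φ d' := hdd
    ext
    · rw [← hφ3 d, ← hφ3 d', hdd]
    · rw [← hφ4 d, ← hφ4 d', hdd]
  have hcard : Fintype.card G.Dart ≤ ((Finset.univ.filter fun g => τ.inv g ≠ g) \
      {f, τ.inv f}).card := by
    rw [← Finset.card_univ]
    refine Finset.card_le_card_of_injOn (fun d => φ d) (fun d _ => ?_) hinj.injOn
    have : τ.inv (φ d) ≠ φ d := fun h => d.adj.1 (by rw [← hφ3 d, ← hφ4 d, h])
    simp [hφ1 d, hφ2 d, this]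
  have hsub : ({f, τ.inv f} : Finset τ.Fl) ⊆ Finset.univ.filter fun g => τ.inv g ≠ g := by
    intro g hg
    rw [Finset.mem_insert, Finset.mem_singleton] at hg
    rcases hg with rfl | rfl
    · simpa using hf
    · simpa [τ.inv_inv] using hf.symm
  have htwo := Finset.card_le_card hsub
  rw [Finset.card_pair hf.symm] at htwo
  rw [Finset.card_sdiff_of_subset hsub, Finset.card_pair hf.symm] at hcard
  have hcount := τ.tree_count
  rw [Nat.card_eq_fintype_card, Fintype.card_subtype] at hcount
  have hpos : 0 < Nat.card τ.V := Nat.card_pos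
  omega

lemma mem_vside_inv {f : τ.Fl} (hf : τ.inv f ≠ f) {v : τ.V} :
    v ∈ τ.vside (τ.inv f) ↔ v ∉ τ.vside f := by
  constructor
  · intro h h'
    refine τ.bd_inv_notMem_vside hf ?_
    rw [vside, Set.mem_ofPred_eq, sideAdj_inv] at h
    refine ReflTransGen.trans ?_ h'
    exact (ReflTransGen.stdSymm (r := τ.sideAdj f)).symm _ _ h
  · intro h
    refine Or.resolve_left (?_ : v ∈ τ.vside f ∨ v ∈ τ.vside (τ.inv f)) h
    clear h
    induction τ.conn v (τ.bd f) using ReflTransGen.head_induction_on with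
    | refl => exact Or.inl (τ.bd_mem_vside f)
    | head h _ ih =>
      obtain ⟨g, rfl, rfl⟩ := h
      by_cases h1 : g = f
      · rw [h1]; exact Or.inl (τ.bd_mem_vside f)
      by_cases h2 : g = τ.inv f
      · rw [h2]; exact Or.inr (τ.bd_mem_vside _)
      · rwa [τ.bd_mem_vside_iff h1 h2,
          τ.bd_mem_vside_iff (f := τ.inv f) h2 (by rwa [τ.inv_inv])]

lemma flagSide_inv {f : τ.Fl} (hf : τ.inv f ≠ f) : τ.flagSide (τ.inv f) = (τ.flagSide f)ᶜ := by
  ext s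
  exact τ.mem_vside_inv hf

lemma vside_subset {f g : τ.Fl} (h : τ.bd f ∈ τ.vside g) (h' : τ.bd g ∉ τ.vside f) :
    τ.vside f ⊆ τ.vside g := by
  intro w hw
  induction hw using ReflTransGen.head_induction_on with
  | refl => exact h
  | head hab hb ih =>
    obtain ⟨e, he1, he2, rfl, rfl⟩ := hab
    have hb' : τ.bd (τ.inv e) ∈ τ.vside f := hb
    refine (τ.bd_mem_vside_iff (fun heg => h' ?_) fun heg => h' ?_).2 ih
    · rw [← heg, τ.bd_mem_vside_iff he1 he2]
      exact hb
    · rwa [heg, τ.inv_inv] at hb'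

lemma flagSide_subset {f g : τ.Fl} (h : τ.bd f ∈ τ.vside g) (h' : τ.bd g ∉ τ.vside f) :
    τ.flagSide f ⊆ τ.flagSide g :=
  fun _ hs => τ.vside_subset h h' hs

section Branches

variable {τ} {v : τ.V}

lemma notMem_vside_inv {φ : τ.Fl} (hφ : τ.inv φ ≠ φ) (hv : τ.bd φ = v) :
    v ∉ τ.vside (τ.inv φ) := by
  rw [τ.mem_vside_inv hφ, not_not, ← hv]
  exact τ.bd_mem_vside φ

lemma branchLabels_edge {φ : τ.Fl} (hφ : τ.inv φ ≠ φ) (hv : τ.bd φ = v) :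
    τ.branchLabels v φ = τ.flagSide (τ.inv φ) := by
  have hvn := notMem_vside_inv hφ hv
  ext s
  rw [mem_flagSide, branchLabels, Set.mem_ofPred_eq, or_iff_right
    (fun h => hφ (by rw [← h, τ.label_fixed])), and_iff_right hφ]
  constructor
  · intro h
    generalize τ.bd (τ.label s) = w at h
    induction h with
    | refl => exact τ.bd_mem_vside _
    | tail _ hbc ih =>
      obtain ⟨h1, h2, g, rfl, rfl⟩ := hbc
      refine (τ.bd_mem_vside_iff (fun h => h2 ?_) (fun h => h1 ?_)).1 ih
      · rw [h, τ.inv_inv, hv]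
      · rw [h, τ.inv_inv, hv]
  · intro h
    have : Std.Symm (τ.avoidAdj v) :=
      ⟨fun a b ⟨h1, h2, g, h3, h4⟩ => ⟨h2, h1, τ.inv g, h4, by rwa [τ.inv_inv]⟩⟩
    refine (ReflTransGen.stdSymm (r := τ.avoidAdj v)).symm _ _ ?_
    · generalize τ.bd (τ.label s) = w at h
      induction h using ReflTransGen.head_induction_on with
      | refl => exact ReflTransGen.refl
      | @head a b hab hb ih =>
        refine ReflTransGen.head ⟨?_, ?_, ?_⟩ ih
        · rintro rfl
          exact hvn (ReflTransGen.head hab hb)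
        · rintro rfl
          exact hvn hb
        · obtain ⟨g, -, -, h⟩ := hab
          exact ⟨g, h⟩

lemma branchLabels_tail (s : γ) : τ.branchLabels v (τ.label s) = {s} := by
  ext t
  simp [branchLabels, τ.label_fixed, τ.label_inj.eq_iff]

lemma exists_vside_inv {w : τ.V} (hw : w ≠ v) :
    ∃ φ, τ.inv φ ≠ φ ∧ τ.bd φ = v ∧ w ∈ τ.vside (τ.inv φ) := by
  refine Or.resolve_left (?_ : w = v ∨ _) hw
  clear hw
  induction τ.conn w v using ReflTransGen.head_induction_on with
  | refl => exact Or.inl rfl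
  | head h _ ih =>
    obtain ⟨g, rfl, rfl⟩ := h
    rcases ih with h | ⟨φ, hφ, hv, h⟩
    · by_cases hg : τ.inv g = g
      · left; rw [← h, hg]
      · refine Or.inr ⟨τ.inv g, by rw [τ.inv_inv]; exact fun h => hg h.symm, h, ?_⟩
        rw [τ.inv_inv]
        exact τ.bd_mem_vside g
    · by_cases h1 : g = φ
      · left; rw [h1, hv]
      right
      refine ⟨φ, hφ, hv, ?_⟩
      by_cases h2 : g = τ.inv φ
      · rw [h2]; exact τ.bd_mem_vside _
      · exact (τ.bd_mem_vside_iff h2 (by rwa [τ.inv_inv])).2 h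

lemma exists_branchLabels (v : τ.V) (s : γ) : ∃ φ ∈ τ.flagsAt v, s ∈ τ.branchLabels v φ := by
  by_cases h : τ.bd (τ.label s) = v
  · exact ⟨τ.label s, h, Or.inl rfl⟩
  · obtain ⟨φ, hφ, hv, h⟩ := exists_vside_inv h
    exact ⟨φ, hv, by rw [branchLabels_edge hφ hv]; exact h⟩

lemma vside_inv_subset {φ ψ : τ.Fl} (hφ : τ.inv φ ≠ φ) (hψ : τ.inv ψ ≠ ψ) (hv : τ.bd φ = v)
    (hv' : τ.bd ψ = v) (hne : ψ ≠ φ) : τ.vside (τ.inv ψ) ⊆ τ.vside φ := by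
  refine τ.vside_subset ?_ ?_
  · rw [← τ.bd_mem_vside_iff hne, hv', ← hv]
    · exact τ.bd_mem_vside φ
    · rintro rfl
      have := notMem_vside_inv hφ hv
      rw [← hv'] at this
      exact this (τ.bd_mem_vside _)
  · rw [hv]
    exact notMem_vside_inv hψ hv'

lemma branchLabels_unique {φ ψ : τ.Fl} (hv : φ ∈ τ.flagsAt v) (hv' : ψ ∈ τ.flagsAt v) {s : γ}
    (h : s ∈ τ.branchLabels v φ) (h' : s ∈ τ.branchLabels v ψ) : φ = ψ := by
  by_contra hne
  by_cases hφ : τ.inv φ = φ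
  · obtain ⟨t, rfl⟩ := τ.label_surj φ hφ
    rw [branchLabels_tail] at h
    obtain rfl : s = t := h
    by_cases hψ : τ.inv ψ = ψ
    · obtain ⟨u, rfl⟩ := τ.label_surj ψ hψ
      rw [branchLabels_tail] at h'
      exact hne (congrArg _ h')
    · rw [branchLabels_edge hψ hv', mem_flagSide, show τ.bd (τ.label s) = v from hv] at h'
      exact notMem_vside_inv hψ hv' h'
  · rw [branchLabels_edge hφ hv, mem_flagSide] at h
    by_cases hψ : τ.inv ψ = ψ
    · obtain ⟨u, rfl⟩ := τ.label_surj ψ hψ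
      rw [branchLabels_tail] at h'
      obtain rfl : s = u := h'
      rw [show τ.bd (τ.label s) = v from hv'] at h
      exact notMem_vside_inv hφ hv h
    · rw [branchLabels_edge hψ hv', mem_flagSide] at h'
      exact (τ.mem_vside_inv hφ).1 h (vside_inv_subset hφ hψ hv hv' (Ne.symm hne) h')

end Branches

section Stable

variable {τ} {W : Set γ}

lemma branchLabels_subset_flagSide {f ψ : τ.Fl} (hf : τ.inv f ≠ f)
    (hψ : ψ ∈ τ.flagsAt (τ.bd f)) (hne : ψ ≠ f) :
    τ.branchLabels (τ.bd f) ψ ⊆ τ.flagSide f := by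
  intro s hs
  by_cases h : τ.inv ψ = ψ
  · obtain ⟨t, rfl⟩ := τ.label_surj ψ h
    rw [branchLabels_tail] at hs
    obtain rfl : s = t := hs
    rw [mem_flagSide, show τ.bd (τ.label s) = τ.bd f from hψ]
    exact τ.bd_mem_vside f
  · rw [branchLabels_edge h hψ] at hs
    exact vside_inv_subset hf h rfl hψ hne hs

lemma exists_two_flags (hτ : τ.PaintedStable W) (f : τ.Fl) :
    ∃ φ ∈ τ.flagsAt (τ.bd f), ∃ ψ ∈ τ.flagsAt (τ.bd f), φ ≠ f ∧ ψ ≠ f ∧ φ ≠ ψ := by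
  have h : 3 ≤ (τ.flagsAt (τ.bd f)).ncard := hτ.1 (τ.bd f)
  have h' : 1 < (τ.flagsAt (τ.bd f) \ {f}).ncard := by
    rw [Set.ncard_sdiff_singleton_of_mem (show f ∈ τ.flagsAt (τ.bd f) from rfl)]
    omega
  obtain ⟨φ, hφ, ψ, hψ, hne⟩ := Set.one_lt_ncard_iff_nontrivial.1 h'
  exact ⟨φ, hφ.1, ψ, hψ.1, hφ.2, hψ.2, hne⟩

lemma flagSide_inter_nonempty (hτ : τ.PaintedStable W) (f : τ.Fl) (hf : τ.inv f ≠ f) :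
    (τ.flagSide f ∩ W).Nonempty := by
  induction hn : (τ.vside f).ncard using Nat.strong_induction_on generalizing f with
  | _ n ih =>
    by_cases h : ∃ ψ, τ.inv ψ ≠ ψ ∧ τ.bd ψ = τ.bd f ∧ ψ ≠ f
    · obtain ⟨ψ, hψ, hv, hne⟩ := h
      have hss := vside_inv_subset hf hψ rfl hv hne
      have hlt : (τ.vside (τ.inv ψ)).ncard < n := by
        rw [← hn]
        refine Set.ncard_lt_ncard ⟨hss, fun h => ?_⟩ (Set.toFinite _)
        exact notMem_vside_inv hψ hv (h (τ.bd_mem_vside f))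
      obtain ⟨s, hs, hsW⟩ := ih _ hlt (τ.inv ψ) (by rw [τ.inv_inv]; exact hψ.symm) rfl
      exact ⟨s, hss hs, hsW⟩
    · have hle : Nat.card {g : τ.Fl // τ.bd g = τ.bd f ∧ τ.inv g ≠ g} ≤ 1 := by
        have : Subsingleton {g : τ.Fl // τ.bd g = τ.bd f ∧ τ.inv g ≠ g} := by
          refine ⟨fun a b => Subtype.ext ?_⟩
          have key : ∀ c : {g : τ.Fl // τ.bd g = τ.bd f ∧ τ.inv g ≠ g}, c.1 = f := fun c => by
            by_contra hc
            exact h ⟨c.1, c.2.2, c.2.1, hc⟩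
          rw [key a, key b]
        exact Finite.card_le_one_iff_subsingleton.2 this
      obtain ⟨s, hs, hv⟩ := hτ.2 _ hle
      refine ⟨s, ?_, hs⟩
      rw [mem_flagSide, hv]
      exact τ.bd_mem_vside f

lemma branchLabels_nonempty (hτ : τ.PaintedStable W) {v : τ.V} {φ : τ.Fl}
    (hφ : φ ∈ τ.flagsAt v) : (τ.branchLabels v φ).Nonempty := by
  by_cases h : τ.inv φ = φ
  · obtain ⟨s, rfl⟩ := τ.label_surj φ h
    exact ⟨s, Or.inl rfl⟩
  · rw [branchLabels_edge h hφ]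
    exact (flagSide_inter_nonempty hτ _ (by rw [τ.inv_inv]; exact Ne.symm h)).mono
      Set.inter_subset_left

lemma two_le_ncard_flagSide [Finite γ] (hτ : τ.PaintedStable W) (f : τ.Fl)
    (hf : τ.inv f ≠ f) : 2 ≤ (τ.flagSide f).ncard := by
  obtain ⟨φ, hφ, ψ, hψ, h1, h2, h3⟩ := exists_two_flags hτ f
  obtain ⟨s, hs⟩ := branchLabels_nonempty hτ hφ
  obtain ⟨t, ht⟩ := branchLabels_nonempty hτ hψ
  refine Set.one_lt_ncard_iff_nontrivial.2
    ⟨s, branchLabels_subset_flagSide hf hφ h1 hs, t, branchLabels_subset_flagSide hf hψ h2 ht, ?_⟩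
  rintro rfl
  exact h3 (branchLabels_unique hφ hψ hs ht)

lemma flagPartition_eq {f : τ.Fl} (hf : τ.inv f ≠ f) :
    τ.flagPartition f = {τ.flagSide f, (τ.flagSide f)ᶜ} := by
  rw [flagPartition, flagSide_inv τ hf]

lemma flagPartition_inv (f : τ.Fl) : τ.flagPartition (τ.inv f) = τ.flagPartition f := by
  rw [flagPartition, flagPartition, τ.inv_inv, Set.pair_comm]

lemma inv_inv_ne {f : τ.Fl} (hf : τ.inv f ≠ f) : τ.inv (τ.inv f) ≠ τ.inv f := by
  rw [τ.inv_inv]; exact hf.symm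

lemma paintedStablePart_flagPartition [Finite γ] (hτ : τ.PaintedStable W) {f : τ.Fl}
    (hf : τ.inv f ≠ f) : PaintedStablePart W (τ.flagPartition f) := by
  have hf' := inv_inv_ne hf
  rw [flagPartition_eq hf, paintedStablePart_pair_iff, ← flagSide_inv τ hf]
  exact ⟨⟨flagSide_inter_nonempty hτ f hf, two_le_ncard_flagSide hτ f hf⟩,
    flagSide_inter_nonempty hτ _ hf', two_le_ncard_flagSide hτ _ hf'⟩

lemma not_crossing_flagSide {f g : τ.Fl} (hf : τ.inv f ≠ f) (hg : τ.inv g ≠ g) :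
    ¬ Crossing (τ.flagSide f) (τ.flagSide g) := by
  rintro ⟨⟨x, hx, hx'⟩, ⟨y, hy, hy'⟩, ⟨z, hz, hz'⟩, ⟨w, hw, hw'⟩⟩
  by_cases h1 : g = f
  · rw [h1] at hy'; exact hy' hy
  by_cases h2 : g = τ.inv f
  · rw [h2, flagSide_inv τ hf] at hx'; exact hx' hx
  have h3 : f ≠ τ.inv g := fun h => h2 (by rw [h, τ.inv_inv])
  have e1 := τ.bd_mem_vside_iff (Ne.symm h1) h3
  have e2 := τ.bd_mem_vside_iff h1 h2
  by_cases hfg : τ.bd f ∈ τ.vside g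
  · by_cases hgf : τ.bd g ∈ τ.vside f
    · refine hw' (τ.flagSide_subset (f := τ.inv f) (e1.1 hfg) ?_ ?_)
      · rw [τ.mem_vside_inv hf, not_not]; exact hgf
      · rw [flagSide_inv τ hf]; exact hw
    · exact hy' (τ.flagSide_subset hfg hgf hy)
  · by_cases hgf : τ.bd g ∈ τ.vside f
    · exact hz (τ.flagSide_subset hgf hfg hz')
    · have := τ.flagSide_subset (f := f) (g := τ.inv g) ((τ.mem_vside_inv hg).2 hfg)
        (fun h => hgf (e2.2 h)) hx
      rw [flagSide_inv τ hg] at this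
      exact this hx'

lemma goodFamily_edgeFamily [Finite γ] (hτ : τ.PaintedStable W) :
    GoodFamily W τ.edgeFamily := by
  constructor
  · rintro _ ⟨f, hf, rfl⟩
    exact paintedStablePart_flagPartition hτ hf
  · rintro _ ⟨f, hf, rfl⟩ _ ⟨g, hg, rfl⟩ hne
    have h1 := paintedStablePart_flagPartition hτ hf
    have h2 := paintedStablePart_flagPartition hτ hg
    rw [flagPartition_eq hf] at h1 hne ⊢
    rw [flagPartition_eq hg] at h2 hne ⊢
    exact (delta_eq_one_iff_of_painted h1 h2 hne).2 (not_crossing_flagSide hf hg)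

lemma exists_flagSide_subset_branch (v : τ.V) {f : τ.Fl} (hf : τ.inv f ≠ f) :
    ∃ g φ, τ.inv g ≠ g ∧ τ.flagPartition g = τ.flagPartition f ∧ φ ∈ τ.flagsAt v ∧
      τ.flagSide g ⊆ τ.branchLabels v φ := by
  have main : ∀ g, τ.inv g ≠ g → v ∉ τ.vside g →
      ∃ φ ∈ τ.flagsAt v, τ.flagSide g ⊆ τ.branchLabels v φ := by
    intro g hg hv
    obtain ⟨φ, hφ, hφv, h⟩ := exists_vside_inv (w := τ.bd g) (v := v)
      (by rintro rfl; exact hv (τ.bd_mem_vside g))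
    refine ⟨φ, hφv, ?_⟩
    rw [branchLabels_edge hφ hφv]
    by_cases hφg : φ = τ.inv g
    · rw [hφg, τ.inv_inv]
    refine τ.flagSide_subset h fun h' => hv ?_
    have hne : φ ≠ g := by
      rintro rfl
      exact hv (hφv ▸ τ.bd_mem_vside φ)
    rw [← hφv, τ.bd_mem_vside_iff hne hφg]
    exact h'
  by_cases hv : v ∈ τ.vside f
  · obtain ⟨φ, h1, h2⟩ := main (τ.inv f) (inv_inv_ne hf)
      (by rw [τ.mem_vside_inv hf]; exact not_not.2 hv)
    exact ⟨_, φ, inv_inv_ne hf, flagPartition_inv f, h1, h2⟩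
  · obtain ⟨φ, h1, h2⟩ := main f hf hv
    exact ⟨f, φ, hf, rfl, h1, h2⟩

end Stable

end LTree

section FaceEquiv

variable {γ : Type} [Finite γ] {W : Set γ}

instance : Fintype (PSP γ W) := Fintype.ofFinite _

/-- The finite set of painted stable partitions belonging to a family. -/
def famFinset (W : Set γ) (E : Set (Set (Set γ))) : Finset (PSP γ W) :=
  Finset.univ.filter fun p => p.1 ∈ E

lemma mem_famFinset {E : Set (Set (Set γ))} {p : PSP γ W} : p ∈ famFinset W E ↔ p.1 ∈ E := by
  simp [famFinset]

lemma isFace_famFinset {E : Set (Set (Set γ))} (h : GoodFamily W E) :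
    IsFace (PSCompat γ W) (famFinset W E) := fun _ hp _ hq hne =>
  h.2 _ (mem_famFinset.1 hp) _ (mem_famFinset.1 hq) fun h => hne (Subtype.ext h)

/-- The good families are the faces of the compatibility complex. -/
def faceEquiv (γ : Type) [Finite γ] (W : Set γ) :
    GoodFam γ W ≃ {F : Finset (PSP γ W) // IsFace (PSCompat γ W) F} where
  toFun E := ⟨famFinset W E.1, isFace_famFinset E.2⟩
  invFun F := ⟨Subtype.val '' (F.1 : Set (PSP γ W)), by
    constructor
    · rintro _ ⟨p, -, rfl⟩
      exact p.2
    · rintro _ ⟨p, hp, rfl⟩ _ ⟨q, hq, rfl⟩ hne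
      exact F.2 p hp q hq fun h => hne (congrArg _ h)⟩
  left_inv E := by
    ext σ
    simp only [Set.mem_image, Finset.mem_coe, mem_famFinset, Subtype.exists]
    constructor
    · rintro ⟨σ, _, h, rfl⟩
      exact h
    · exact fun h => ⟨σ, E.2.1 σ h, h, rfl⟩
  right_inv F := by
    ext p
    simp only [mem_famFinset, Set.mem_image, Finset.mem_coe]
    exact ⟨fun ⟨q, hq, h⟩ => Subtype.ext h ▸ hq, fun h => ⟨p, h, rfl⟩⟩

lemma goodFamily_of_isFace {E : Set (Set (Set γ))} (hE : ∀ σ ∈ E, PaintedStablePart W σ)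
    (h : IsFace (PSCompat γ W) (famFinset W E)) : GoodFamily W E :=
  ⟨hE, fun σ hσ σ' hσ' hne => h ⟨σ, hE σ hσ⟩ (mem_famFinset.2 hσ) ⟨σ', hE σ' hσ'⟩
    (mem_famFinset.2 hσ') fun h => hne (congrArg Subtype.val h)⟩

variable (k : Type) [CommRing k]

lemma muE_eq_faceVec {E : Set (Set (Set γ))} (hE : ∀ σ ∈ E, PaintedStablePart W σ) :
    muE γ W k E = faceVec (faceEquiv γ W) (famFinset W E) := by
  by_cases h : GoodFamily W E
  · have := faceVec_apply_equiv (k := k) (faceEquiv γ W) ⟨E, h⟩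
    rw [muE, dif_pos h, ← this]
    rfl
  · rw [muE, dif_neg h, faceVec_of_not]
    exact fun h' => h (goodFamily_of_isFace hE h')

lemma famFinset_union_singleton {E : Set (Set (Set γ))} (p : PSP γ W) :
    famFinset W (E ∪ {p.1}) = insert p (famFinset W E) := by
  ext q
  simp only [mem_famFinset, Finset.mem_insert, Set.mem_union, Set.mem_singleton_iff]
  rw [or_comm, Subtype.ext_iff]

lemma muE_union_singleton {E : Set (Set (Set γ))} (hE : ∀ σ ∈ E, PaintedStablePart W σ)
    (p : PSP γ W) :
    muE γ W k (E ∪ {p.1}) = faceVec (faceEquiv γ W) (insert p (famFinset W E)) := by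
  rw [muE_eq_faceVec, famFinset_union_singleton]
  rintro σ (h | rfl)
  exacts [hE σ h, p.2]

end FaceEquiv

namespace LTree

variable {γ : Type} {τ : LTree γ} {W : Set γ} {v : τ.V}

/-- The labels on the branches at `v` starting with the flags in `P`. -/
def flagUnion (τ : LTree γ) (v : τ.V) (P : Set τ.Fl) : Set γ := ⋃ φ ∈ P, τ.branchLabels v φ

lemma mem_flagUnion {P : Set τ.Fl} (hP : P ⊆ τ.flagsAt v) {φ : τ.Fl} (hφ : φ ∈ τ.flagsAt v)
    {s : γ} (hs : s ∈ τ.branchLabels v φ) : s ∈ τ.flagUnion v P ↔ φ ∈ P := by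
  simp only [flagUnion, Set.mem_iUnion]
  constructor
  · rintro ⟨ψ, hψ, h⟩
    rwa [branchLabels_unique hφ (hP hψ) hs h]
  · exact fun h => ⟨φ, h, hs⟩

lemma flagUnion_injOn (hτ : τ.PaintedStable W) (v : τ.V) :
    Set.InjOn (τ.flagUnion v) {P | P ⊆ τ.flagsAt v} := by
  intro P hP Q hQ h
  ext φ
  have key : ∀ φ ∈ τ.flagsAt v, φ ∈ P ↔ φ ∈ Q := by
    intro φ hφ
    obtain ⟨s, hs⟩ := branchLabels_nonempty hτ hφ
    rw [← mem_flagUnion hP hφ hs, h, mem_flagUnion hQ hφ hs]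
  exact ⟨fun h => (key φ (hP h)).1 h, fun h => (key φ (hQ h)).2 h⟩

lemma subset_flagsAt {α : Set (Set τ.Fl)} (hα : IsTwoPartitionOn (τ.flagsAt v) α)
    {P : Set τ.Fl} (hP : P ∈ α) : P ⊆ τ.flagsAt v := by
  obtain ⟨A, B, rfl, -, -, -, -, h⟩ := hα
  rw [← h]
  rcases hP with rfl | rfl
  exacts [Set.subset_union_left, Set.subset_union_right]

lemma inducedSPart_injOn (hτ : τ.PaintedStable W) (v : τ.V) :
    Set.InjOn (τ.inducedSPart v) {α | IsTwoPartitionOn (τ.flagsAt v) α} := by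
  intro α hα β hβ h
  have key : ∀ α β : Set (Set τ.Fl), IsTwoPartitionOn (τ.flagsAt v) α →
      IsTwoPartitionOn (τ.flagsAt v) β → τ.inducedSPart v α = τ.inducedSPart v β → α ⊆ β := by
    intro α β hα hβ h P hP
    have : τ.flagUnion v P ∈ τ.inducedSPart v β := h ▸ Set.mem_image_of_mem _ hP
    obtain ⟨Q, hQ, hPQ⟩ := this
    rwa [← flagUnion_injOn hτ v (subset_flagsAt hβ hQ) (subset_flagsAt hα hP) hPQ]
  exact Set.Subset.antisymm (key α β hα hβ h) (key β α hβ hα h.symm)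

lemma splitsPair_inducedSPart (hτ : τ.PaintedStable W) {α : Set (Set τ.Fl)}
    (hα : IsTwoPartitionOn (τ.flagsAt v) α)
    {I J K L : τ.Fl} (hI : I ∈ τ.flagsAt v) (hJ : J ∈ τ.flagsAt v) (hK : K ∈ τ.flagsAt v)
    (hL : L ∈ τ.flagsAt v) {i j a b : γ} (hi : i ∈ τ.branchLabels v I)
    (hj : j ∈ τ.branchLabels v J) (ha : a ∈ τ.branchLabels v K) (hb : b ∈ τ.branchLabels v L) :
    SplitsPair (τ.inducedSPart v α) i j a b ↔ SplitsPair α I J K L := by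
  constructor
  · rintro ⟨_, ⟨P, hP, rfl⟩, _, ⟨Q, hQ, rfl⟩, hne, h1, h2, h3, h4⟩
    have hP' := subset_flagsAt hα hP
    have hQ' := subset_flagsAt hα hQ
    exact ⟨P, hP, Q, hQ, fun h => hne (by rw [h]), (mem_flagUnion hP' hI hi).1 h1,
      (mem_flagUnion hP' hJ hj).1 h2, (mem_flagUnion hQ' hK ha).1 h3,
        (mem_flagUnion hQ' hL hb).1 h4⟩
  · rintro ⟨P, hP, Q, hQ, hne, h1, h2, h3, h4⟩
    have hP' := subset_flagsAt hα hP
    have hQ' := subset_flagsAt hα hQ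
    exact ⟨_, ⟨P, hP, rfl⟩, _, ⟨Q, hQ, rfl⟩, fun h => hne (flagUnion_injOn hτ v hP' hQ' h),
      (mem_flagUnion hP' hI hi).2 h1,
      (mem_flagUnion hP' hJ hj).2 h2, (mem_flagUnion hQ' hK ha).2 h3,
        (mem_flagUnion hQ' hL hb).2 h4⟩

lemma eps_inducedSPart (hτ : τ.PaintedStable W) {α : Set (Set τ.Fl)}
    (hα : IsTwoPartitionOn (τ.flagsAt v) α)
    {I J K L : τ.Fl} (hI : I ∈ τ.flagsAt v) (hJ : J ∈ τ.flagsAt v) (hK : K ∈ τ.flagsAt v)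
    (hL : L ∈ τ.flagsAt v) {i j a b : γ} (hi : i ∈ τ.branchLabels v I)
    (hj : j ∈ τ.branchLabels v J) (ha : a ∈ τ.branchLabels v K) (hb : b ∈ τ.branchLabels v L) :
    eps (τ.inducedSPart v α) i j a b = eps α I J K L := by
  simp only [eps, splitsPair_inducedSPart hτ hα hI hJ hK hL hi hj ha hb,
    splitsPair_inducedSPart hτ hα hK hJ hI hL ha hj hi hb]

lemma eps_edgeFamily_eq_zero {I J K L : τ.Fl} (hI : I ∈ τ.flagsAt v) (hJ : J ∈ τ.flagsAt v)
    (hK : K ∈ τ.flagsAt v) (hL : L ∈ τ.flagsAt v) (hIJ : I ≠ J) (hJK : J ≠ K) (hIL : I ≠ L)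
    (hKL : K ≠ L) {i j a b : γ} (hi : i ∈ τ.branchLabels v I)
    (hj : j ∈ τ.branchLabels v J) (ha : a ∈ τ.branchLabels v K) (hb : b ∈ τ.branchLabels v L)
    {σ : Set (Set γ)} (hσ : σ ∈ τ.edgeFamily) : eps σ i j a b = 0 := by
  obtain ⟨f, hf, rfl⟩ := hσ
  obtain ⟨g, φ, hg, hgf, hφ, hsub⟩ := exists_flagSide_subset_branch v hf
  rw [← hgf, flagPartition_eq hg, eps_pair_eq_zero_iff]
  have key : ∀ {M s}, M ∈ τ.flagsAt v → s ∈ τ.branchLabels v M → s ∈ τ.flagSide g → M = φ :=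
    fun hM hs h => branchLabels_unique hM hφ hs (hsub h)
  refine ⟨fun h => hIJ ?_, fun h => hKL ?_, fun h => hJK ?_, fun h => hIL ?_⟩
  · rw [key hI hi h.1, key hJ hj h.2.1]
  · rw [key hK ha h.2.2.1, key hL hb h.2.2.2]
  · rw [key hK ha h.1, key hJ hj h.2.1]
  · rw [key hI hi h.2.2.1, key hL hb h.2.2.2]

lemma exists_inducedSPart [Finite γ] (hτ : τ.PaintedStable W)
    {I J K L : τ.Fl} (hI : I ∈ τ.flagsAt v) (hJ : J ∈ τ.flagsAt v)
    (hK : K ∈ τ.flagsAt v) (hL : L ∈ τ.flagsAt v) (hIJ : I ≠ J) (hJK : J ≠ K)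
    (hIL : I ≠ L) (hKL : K ≠ L) {i j a b : γ} (hi : i ∈ τ.branchLabels v I)
    (hj : j ∈ τ.branchLabels v J) (ha : a ∈ τ.branchLabels v K) (hb : b ∈ τ.branchLabels v L)
    {p : PSP γ W} (hp : IsFace (PSCompat γ W) (insert p (famFinset W τ.edgeFamily)))
    (hpF : p ∉ famFinset W τ.edgeFamily) (heps : eps p.1 i j a b ≠ 0) :
    ∃ α ∈ τ.VertexParts W v, τ.inducedSPart v α = p.1 := by
  obtain ⟨A, hA⟩ := p.2.exists_eq
  have hAm : A ∈ p.1 := by rw [hA]; simp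
  rw [hA, Ne, eps_pair_eq_zero_iff] at heps
  have hbr : ∀ φ ∈ τ.flagsAt v, τ.branchLabels v φ ⊆ A ∨ τ.branchLabels v φ ⊆ Aᶜ := by
    intro φ hφ
    by_cases h : τ.inv φ = φ
    · obtain ⟨s, rfl⟩ := τ.label_surj φ h
      rw [branchLabels_tail, Set.singleton_subset_iff, Set.singleton_subset_iff]
      exact Classical.em _
    · rw [branchLabels_edge h hφ]
      have hi' := inv_inv_ne h
      have hq := paintedStablePart_flagPartition hτ hi'
      have hqF : (⟨_, hq⟩ : PSP γ W) ∈ famFinset W τ.edgeFamily :=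
        mem_famFinset.2 ⟨_, hi', rfl⟩
      have hc := not_crossing_of_isFace hp (Finset.mem_insert_self _ _)
        (Finset.mem_insert_of_mem hqF) hAm (show τ.flagSide (τ.inv φ) ∈ τ.flagPartition (τ.inv φ) by
          rw [flagPartition]; simp) fun h => hpF (h ▸ hqF)
      by_contra hcon
      simp only [not_or, Set.not_subset, Set.mem_compl_iff, not_not] at hcon
      obtain ⟨⟨x, hx⟩, ⟨y, hy⟩⟩ := hcon
      have key : ∀ {M s}, M ∈ τ.flagsAt v → s ∈ τ.branchLabels v M → s ∈ τ.flagSide (τ.inv φ) →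
          M = φ := fun hM hs h' => branchLabels_unique hM hφ hs (by rwa [branchLabels_edge h hφ])
      have hout : ∀ {M N s t}, M ∈ τ.flagsAt v → N ∈ τ.flagsAt v → M ≠ N →
          s ∈ τ.branchLabels v M → t ∈ τ.branchLabels v N →
          s ∉ τ.flagSide (τ.inv φ) ∨ t ∉ τ.flagSide (τ.inv φ) := by
        intro M N s t hM hN hne hs ht
        by_contra! h'
        exact hne ((key hM hs h'.1).trans (key hN ht h'.2).symm)
      have hcross : ∀ {s t : γ}, s ∈ A → s ∉ τ.flagSide (τ.inv φ) → t ∉ A →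
          t ∉ τ.flagSide (τ.inv φ) → False := fun hs hs' ht ht' =>
        hc ⟨⟨y, hy.2, hy.1⟩, ⟨_, hs, hs'⟩, ⟨x, hx.2, hx.1⟩, ⟨_, ht, ht'⟩⟩
      have o1 := hout hI hJ hIJ hi hj
      have o2 := hout hK hL hKL ha hb
      have o3 := hout hK hJ hJK.symm ha hj
      have o4 := hout hI hL hIL hi hb
      have hcon : (∃ s ∈ A, s ∉ τ.flagSide (τ.inv φ)) ∧ ∃ s ∉ A, s ∉ τ.flagSide (τ.inv φ) := by
        by_cases c1 : i ∈ A <;> by_cases c2 : j ∈ A <;> by_cases c3 : a ∈ A <;>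
          by_cases c4 : b ∈ A <;> simp only [c1, c2, c3, c4, not_true, not_false_eq_true,
            and_true, and_false, and_self] at heps
        · exact ⟨o1.elim (fun h => ⟨i, c1, h⟩) fun h => ⟨j, c2, h⟩,
            o2.elim (fun h => ⟨a, c3, h⟩) fun h => ⟨b, c4, h⟩⟩
        · exact ⟨o4.elim (fun h => ⟨i, c1, h⟩) fun h => ⟨b, c4, h⟩,
            o3.elim (fun h => ⟨a, c3, h⟩) fun h => ⟨j, c2, h⟩⟩
        · exact ⟨o3.elim (fun h => ⟨a, c3, h⟩) fun h => ⟨j, c2, h⟩,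
            o4.elim (fun h => ⟨i, c1, h⟩) fun h => ⟨b, c4, h⟩⟩
        · exact ⟨o2.elim (fun h => ⟨a, c3, h⟩) fun h => ⟨b, c4, h⟩,
            o1.elim (fun h => ⟨i, c1, h⟩) fun h => ⟨j, c2, h⟩⟩
      obtain ⟨⟨s, hs, hs'⟩, t, ht, ht'⟩ := hcon
      exact hcross hs hs' ht ht'
  have hU : ∀ B : Set γ, (B = A ∨ B = Aᶜ) →
      τ.flagUnion v {φ | φ ∈ τ.flagsAt v ∧ τ.branchLabels v φ ⊆ B} = B := by
    intro B hB
    ext s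
    simp only [flagUnion, Set.mem_iUnion]
    constructor
    · rintro ⟨φ, h, hs⟩
      exact h.2 hs
    · intro hs
      obtain ⟨φ, hφ, h⟩ := exists_branchLabels v s
      refine ⟨φ, ⟨hφ, ?_⟩, h⟩
      have := hbr φ hφ
      rcases hB with rfl | rfl
      · exact this.resolve_right fun h' => h' h hs
      · exact this.resolve_left fun h' => hs (h' h)
  have hind : τ.inducedSPart v {{φ | φ ∈ τ.flagsAt v ∧ τ.branchLabels v φ ⊆ A},
      {φ | φ ∈ τ.flagsAt v ∧ τ.branchLabels v φ ⊆ Aᶜ}} = p.1 := by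
    rw [inducedSPart, Set.image_pair, hA]
    exact congrArg₂ (fun x y => ({x, y} : Set (Set γ))) (hU A (Or.inl rfl)) (hU Aᶜ (Or.inr rfl))
  have hne : ∀ B : Set γ, (B = A ∨ B = Aᶜ) → B.Nonempty →
      {φ | φ ∈ τ.flagsAt v ∧ τ.branchLabels v φ ⊆ B}.Nonempty := by
    rintro B hB ⟨s, hs⟩
    rw [← hU B hB] at hs
    simp only [flagUnion, Set.mem_iUnion] at hs
    obtain ⟨φ, h, -⟩ := hs
    exact ⟨φ, h⟩
  have hps := p.2
  rw [hA, paintedStablePart_pair_iff] at hps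
  have hAne := hps.1.1.mono Set.inter_subset_left
  have hAne' := hps.2.1.mono Set.inter_subset_left
  have hdisj : Disjoint {φ | φ ∈ τ.flagsAt v ∧ τ.branchLabels v φ ⊆ A}
      {φ | φ ∈ τ.flagsAt v ∧ τ.branchLabels v φ ⊆ Aᶜ} := by
    rw [Set.disjoint_left]
    rintro φ ⟨h1, h2⟩ ⟨-, h3⟩
    obtain ⟨s, hs⟩ := branchLabels_nonempty hτ h1
    exact h3 hs (h2 hs)
  refine ⟨_, ⟨⟨_, _, rfl, ?_, hne A (Or.inl rfl) hAne, hne Aᶜ (Or.inr rfl) hAne', hdisj, ?_⟩,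
    by rw [hind]; exact p.2⟩, hind⟩
  · intro h
    rw [← h, disjoint_self] at hdisj
    exact (hne A (Or.inl rfl) hAne).ne_empty hdisj
  · ext φ
    constructor
    · rintro (h | h) <;> exact h.1
    · exact fun h => (hbr φ h).imp (fun h' => ⟨h, h'⟩) fun h' => ⟨h, h'⟩

variable (k : Type) [CommRing k]

theorem stdRelH_eq_linkRel [Finite γ] (hτ : τ.PaintedStable W)
    {I J K L : τ.Fl} (hI : I ∈ τ.flagsAt v) (hJ : J ∈ τ.flagsAt v)
    (hK : K ∈ τ.flagsAt v) (hL : L ∈ τ.flagsAt v) (hIJ : I ≠ J) (hJK : J ≠ K)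
    (hIL : I ≠ L) (hKL : K ≠ L) {i j a b : γ} (hi : i ∈ τ.branchLabels v I)
    (hj : j ∈ τ.branchLabels v J) (ha : a ∈ τ.branchLabels v K) (hb : b ∈ τ.branchLabels v L) :
    stdRelH γ W k τ v I J K L =
      linkRel (faceEquiv γ W) (famFinset W τ.edgeFamily) (epsForm W k i j a b) := by
  have hgood := goodFamily_edgeFamily hτ
  have h1 : stdRelH γ W k τ v I J K L = ∑ᶠ σ ∈ τ.inducedSPart v '' τ.VertexParts W v,
      eps σ i j a b • muE γ W k (τ.edgeFamily ∪ {σ}) := by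
    rw [finsum_mem_image ((inducedSPart_injOn hτ v).mono fun α h => h.1)]
    refine finsum_mem_congr rfl fun α hα => ?_
    rw [eps_inducedSPart hτ hα.1 hI hJ hK hL hi hj ha hb]
  have h2 : τ.inducedSPart v '' τ.VertexParts W v = Subtype.val ''
      {p : PSP γ W | p.1 ∈ τ.inducedSPart v '' τ.VertexParts W v} := by
    ext σ
    constructor
    · rintro ⟨α, hα, rfl⟩
      exact ⟨⟨_, hα.2⟩, ⟨α, hα, rfl⟩, rfl⟩
    · rintro ⟨p, hp, rfl⟩
      exact hp
  rw [h1, h2, finsum_mem_image Subtype.val_injective.injOn, linkRel,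
    finsum_mem_eq_finite_toFinset_sum _ (Set.toFinite _)]
  have hzero : ∀ p ∈ famFinset W τ.edgeFamily, eps p.1 i j a b = 0 := fun p hp =>
    eps_edgeFamily_eq_zero hI hJ hK hL hIJ hJK hIL hKL hi hj ha hb (mem_famFinset.1 hp)
  refine Finset.sum_congr_of_eq_on_inter (fun p _ hp => ?_) (fun p hp hp' => ?_) fun p _ _ => ?_
  · rw [Finset.mem_compl, not_not] at hp
    rw [hzero p hp, zero_smul]
  · rw [Finset.mem_compl] at hp
    rw [Set.Finite.mem_toFinset] at hp'
    by_cases h0 : eps p.1 i j a b = 0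
    · rw [epsForm, h0, Int.cast_zero, zero_smul]
    · rw [faceVec_of_not, smul_zero]
      exact fun h => hp'
        (exists_inducedSPart hτ hI hJ hK hL hIJ hJK hIL hKL hi hj ha hb h hp h0)
  · rw [muE_union_singleton k hgood.1, epsForm, Int.cast_smul_eq_zsmul]

end LTree

section Laminar

variable {γ : Type} {W : Set γ} {r : γ} {𝓛 : Set (Set γ)}

/-- A laminar family of sets avoiding the root label `r`, as given by the parts not containing
`r` of the members of a good family. -/
structure IsRootedLaminar (W : Set γ) (r : γ) (𝓛 : Set (Set γ)) : Prop where
  root_mem : {r}ᶜ ∈ 𝓛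
  notMem : ∀ A ∈ 𝓛, r ∉ A
  two_le : ∀ A ∈ 𝓛, 2 ≤ A.ncard
  nested : ∀ A ∈ 𝓛, ∀ B ∈ 𝓛, A ⊆ B ∨ B ⊆ A ∨ Disjoint A B
  white : ∀ A ∈ 𝓛, (A ∩ W).Nonempty
  white_compl : ∀ A ∈ 𝓛, A ≠ {r}ᶜ → (Aᶜ ∩ W).Nonempty

/-- The nodes below the root: the nonmaximal members of the family and the singletons. -/
def IsChild (r : γ) (𝓛 : Set (Set γ)) (X : Set γ) : Prop :=
  (X ∈ 𝓛 ∨ ∃ s, s ≠ r ∧ X = {s}) ∧ X ≠ {r}ᶜ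

namespace IsRootedLaminar

lemma nonempty (h : IsRootedLaminar W r 𝓛) {A : Set γ} (hA : A ∈ 𝓛) : A.Nonempty :=
  (h.white A hA).mono Set.inter_subset_left

lemma subset_root (h : IsRootedLaminar W r 𝓛) {A : Set γ} (hA : A ∈ 𝓛) : A ⊆ {r}ᶜ :=
  Set.subset_compl_singleton_iff.2 (h.notMem A hA)

lemma singleton_notMem (h : IsRootedLaminar W r 𝓛) (s : γ) : {s} ∉ 𝓛 := fun hs => by
  have := h.two_le _ hs
  rw [Set.ncard_singleton] at this
  omega

lemma singleton_ssubset (h : IsRootedLaminar W r 𝓛) {A : Set γ} (hA : A ∈ 𝓛) {s : γ} :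
    {s} ⊂ A ↔ s ∈ A :=
  ⟨fun hs => hs.1 rfl, fun hs => (Set.singleton_subset_iff.2 hs).ssubset_of_ne
    fun h' => h.singleton_notMem s (h' ▸ hA)⟩

lemma isChild_singleton (h : IsRootedLaminar W r 𝓛) {s : γ} (hs : s ≠ r) :
    IsChild r 𝓛 {s} :=
  ⟨Or.inr ⟨s, hs, rfl⟩, fun h' => h.singleton_notMem s (h' ▸ h.root_mem)⟩

lemma child_nonempty (h : IsRootedLaminar W r 𝓛) {X : Set γ} (hX : IsChild r 𝓛 X) :
    X.Nonempty := by
  rcases hX.1 with hX | ⟨s, -, rfl⟩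
  exacts [h.nonempty hX, Set.singleton_nonempty s]

lemma child_ssubset_root (h : IsRootedLaminar W r 𝓛) {X : Set γ} (hX : IsChild r 𝓛 X) :
    X ⊂ {r}ᶜ := by
  refine LE.le.ssubset_of_ne ?_ hX.2
  rcases hX.1 with hX | ⟨s, hs, rfl⟩
  · exact h.subset_root hX
  · exact Set.singleton_subset_iff.2 hs

lemma exists_parent [Finite γ] (h : IsRootedLaminar W r 𝓛) {X : Set γ} (hX : IsChild r 𝓛 X) :
    ∃ B ∈ 𝓛, X ⊂ B ∧ ∀ C ∈ 𝓛, X ⊂ C → B ⊆ C := by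
  obtain ⟨B, ⟨hB, hXB⟩, hmin⟩ := Set.Finite.exists_minimal
    (Set.toFinite {B | B ∈ 𝓛 ∧ X ⊂ B}) ⟨_, h.root_mem, h.child_ssubset_root hX⟩
  refine ⟨B, hB, hXB, fun C hC hXC => ?_⟩
  rcases h.nested B hB C hC with h' | h' | h'
  · exact h'
  · exact hmin ⟨hC, hXC⟩ h'
  · obtain ⟨x, hx⟩ := h.child_nonempty hX
    exact absurd (hXC.1 hx) (Set.disjoint_left.1 h' (hXB.1 hx))

variable [Finite γ] (h : IsRootedLaminar W r 𝓛)

/-- The smallest member of the family strictly containing a child. -/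
def parent (X : {X // IsChild r 𝓛 X}) : 𝓛 :=
  ⟨(h.exists_parent X.2).choose, (h.exists_parent X.2).choose_spec.1⟩

lemma ssubset_parent (X : {X // IsChild r 𝓛 X}) : X.1 ⊂ (h.parent X).1 :=
  (h.exists_parent X.2).choose_spec.2.1

lemma parent_subset (X : {X // IsChild r 𝓛 X}) {C : Set γ} (hC : C ∈ 𝓛) (hXC : X.1 ⊂ C) :
    (h.parent X).1 ⊆ C :=
  (h.exists_parent X.2).choose_spec.2.2 C hC hXC

lemma exists_child (A : 𝓛) {s : γ} (hs : s ∈ A.1) : ∃ X, s ∈ X.1 ∧ h.parent X = A := by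
  have hsr : s ≠ r := fun h' => h.notMem A.1 A.2 (h' ▸ hs)
  obtain ⟨X, ⟨hX, hsX, hXA⟩, hmax⟩ := Set.Finite.exists_maximal
    (Set.toFinite {X | IsChild r 𝓛 X ∧ s ∈ X ∧ X ⊂ A.1})
    ⟨{s}, h.isChild_singleton hsr, rfl, (h.singleton_ssubset A.2).2 hs⟩
  refine ⟨⟨X, hX⟩, hsX, Subtype.ext ?_⟩
  by_contra hne
  have hlt := (h.parent_subset ⟨X, hX⟩ A.2 hXA).ssubset_of_ne hne
  have hsub := h.ssubset_parent ⟨X, hX⟩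
  refine hsub.2 (hmax ⟨⟨Or.inl (h.parent _).2, fun h' => ?_⟩, hsub.1 hsX, hlt⟩ hsub.1)
  rw [h'] at hlt
  exact hlt.2 (h.subset_root A.2)

end IsRootedLaminar

/-- The flags of the rooted tree of a laminar family: an upward flag for every member and a
downward flag for every child. -/
abbrev LamFlag (r : γ) (𝓛 : Set (Set γ)) := 𝓛 ⊕ {X // IsChild r 𝓛 X}

/-- The involution exchanging the two flags of every edge. -/
def lamInv : LamFlag r 𝓛 → LamFlag r 𝓛
  | Sum.inl A => if hA : A.1 = {r}ᶜ then Sum.inl A else Sum.inr ⟨A.1, Or.inl A.2, hA⟩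
  | Sum.inr X => if hX : X.1 ∈ 𝓛 then Sum.inl ⟨X.1, hX⟩ else Sum.inr X

lemma lamInv_inl_root {A : 𝓛} (hA : A.1 = {r}ᶜ) :
    lamInv (r := r) (Sum.inl A) = Sum.inl A := dif_pos hA

lemma lamInv_inl {A : 𝓛} (hA : A.1 ≠ {r}ᶜ) :
    lamInv (r := r) (Sum.inl A) = Sum.inr ⟨A.1, Or.inl A.2, hA⟩ := dif_neg hA

lemma lamInv_inr {X : {X // IsChild r 𝓛 X}} (hX : X.1 ∈ 𝓛) :
    lamInv (Sum.inr X) = Sum.inl ⟨X.1, hX⟩ := dif_pos hX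

lemma lamInv_inr_leaf {X : {X // IsChild r 𝓛 X}} (hX : X.1 ∉ 𝓛) :
    lamInv (Sum.inr X) = Sum.inr X := dif_neg hX

lemma lamInv_lamInv (f : LamFlag r 𝓛) : lamInv (lamInv f) = f := by
  rcases f with A | X
  · by_cases hA : A.1 = {r}ᶜ
    · rw [lamInv_inl_root hA, lamInv_inl_root hA]
    · rw [lamInv_inl hA, lamInv_inr A.2]
  · by_cases hX : X.1 ∈ 𝓛
    · rw [lamInv_inr hX]
      exact lamInv_inl (A := ⟨X.1, hX⟩) X.2.2
    · rw [lamInv_inr_leaf hX, lamInv_inr_leaf hX]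

lemma lamInv_inl_ne_iff {A : 𝓛} : lamInv (r := r) (Sum.inl A) ≠ Sum.inl A ↔ A.1 ≠ {r}ᶜ := by
  by_cases hA : A.1 = {r}ᶜ
  · simp [lamInv_inl_root hA, hA]
  · simp [lamInv_inl hA, hA]

lemma lamInv_inr_ne_iff {X : {X // IsChild r 𝓛 X}} :
    lamInv (Sum.inr X) ≠ Sum.inr X ↔ X.1 ∈ 𝓛 := by
  by_cases hX : X.1 ∈ 𝓛
  · simp [lamInv_inr hX, hX]
  · simp [lamInv_inr_leaf hX, hX]

namespace IsRootedLaminar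

variable (h : IsRootedLaminar W r 𝓛)

/-- The tail of a label. -/
def label (s : γ) : LamFlag r 𝓛 :=
  if hs : s = r then Sum.inl ⟨_, h.root_mem⟩ else Sum.inr ⟨_, h.isChild_singleton hs⟩

lemma label_root : h.label r = Sum.inl ⟨_, h.root_mem⟩ := dif_pos rfl

lemma label_of_ne {s : γ} (hs : s ≠ r) : h.label s = Sum.inr ⟨_, h.isChild_singleton hs⟩ :=
  dif_neg hs
variable [Finite γ]

/-- The vertex of a flag. -/
def bd : LamFlag r 𝓛 → 𝓛
  | Sum.inl A => A
  | Sum.inr X => h.parent X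

lemma ascend_induction {p : 𝓛 → Prop} (A : 𝓛)
    (ih : ∀ B : 𝓛, (∀ hB : B.1 ≠ {r}ᶜ, p (h.parent ⟨B.1, Or.inl B.2, hB⟩)) → p B) : p A := by
  induction hn : (A.1ᶜ).ncard using Nat.strong_induction_on generalizing A with
  | _ n ihn =>
    refine ih A fun hA => ihn _ ?_ _ rfl
    rw [← hn]
    exact Set.ncard_lt_ncard (compl_lt_compl_iff_lt.2
      (h.ssubset_parent ⟨A.1, Or.inl A.2, hA⟩)) (Set.toFinite _)

lemma card_edges (h : IsRootedLaminar W r 𝓛) :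
     Nat.card {f : LamFlag r 𝓛 // lamInv f ≠ f} + 2 = 2 * Nat.card 𝓛 := by
  let R : 𝓛 := ⟨_, h.root_mem⟩
  let e : {A : 𝓛 // A ≠ R} ⊕ {A : 𝓛 // A ≠ R} → {f : LamFlag r 𝓛 // lamInv f ≠ f} := fun x =>
    match x with
    | Sum.inl A => ⟨Sum.inl A.1, lamInv_inl_ne_iff.2 fun h' => A.2 (Subtype.ext h')⟩
    | Sum.inr A => ⟨Sum.inr ⟨A.1.1, Or.inl A.1.2, fun h' => A.2 (Subtype.ext h')⟩,
        lamInv_inr_ne_iff.2 A.1.2⟩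
  have he : Function.Bijective e := by
    constructor
    · rintro (A | A) (B | B) hAB
      · have := Sum.inl_injective (congrArg Subtype.val hAB)
        rw [Subtype.ext this]
      · exact absurd (congrArg Subtype.val hAB) Sum.inl_ne_inr
      · exact absurd (congrArg Subtype.val hAB) Sum.inr_ne_inl
      · have := congrArg Subtype.val (Sum.inr_injective (congrArg Subtype.val hAB))
        rw [Subtype.ext (Subtype.ext this)]
    · rintro ⟨A | X, hf⟩
      · exact ⟨Sum.inl ⟨A, fun h' => lamInv_inl_ne_iff.1 hf (congrArg Subtype.val h')⟩, rfl⟩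
      · exact ⟨Sum.inr ⟨⟨X.1, lamInv_inr_ne_iff.1 hf⟩,
          fun h' => X.2.2 (congrArg Subtype.val h')⟩, rfl⟩
  have h1 : Nat.card {A : 𝓛 // A ≠ R} + 1 = Nat.card 𝓛 := by
    have := Set.ncard_add_ncard_compl ({R} : Set 𝓛)
    rw [Set.ncard_singleton] at this
    rw [← this, add_comm]
    rfl
  rw [← Nat.card_congr (Equiv.ofBijective e he), Nat.card_sum]
  omega

/-- The rooted tree of a laminar family. -/
abbrev tree : LTree γ where
  V := 𝓛
  Fl := LamFlag r 𝓛
  bd := h.bd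
  inv := lamInv
  inv_inv := lamInv_lamInv
  label := h.label
  label_fixed s := by
    by_cases hs : s = r
    · rw [hs, h.label_root, lamInv_inl_root rfl]
    · rw [h.label_of_ne hs, lamInv_inr_leaf (h.singleton_notMem s)]
  label_inj s t hst := by
    by_cases hs : s = r <;> by_cases ht : t = r
    · rw [hs, ht]
    · rw [hs, h.label_root, h.label_of_ne ht] at hst
      exact absurd hst Sum.inl_ne_inr
    · rw [ht, h.label_root, h.label_of_ne hs] at hst
      exact absurd hst Sum.inr_ne_inl
    · rw [h.label_of_ne hs, h.label_of_ne ht] at hst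
      exact Set.singleton_injective (congrArg Subtype.val (Sum.inr_injective hst))
  label_surj f hf := by
    rcases f with A | X
    · have hA : A.1 = {r}ᶜ := by
        by_contra hA
        exact lamInv_inl_ne_iff.2 hA hf
      exact ⟨r, by rw [h.label_root]; exact congrArg _ (Subtype.ext hA.symm)⟩
    · have hX : X.1 ∉ 𝓛 := fun hX => lamInv_inr_ne_iff.2 hX hf
      obtain ⟨s, hs, hXs⟩ := X.2.1.resolve_left hX
      exact ⟨s, by rw [h.label_of_ne hs]; exact congrArg _ (Subtype.ext hXs.symm)⟩
  conn := by
    have hsymm : Std.Symm fun a b => ∃ f, h.bd f = a ∧ h.bd (lamInv f) = b :=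
      ⟨fun a b ⟨f, h1, h2⟩ => ⟨lamInv f, h2, by rw [lamInv_lamInv, h1]⟩⟩
    have key : ∀ A : 𝓛, Relation.ReflTransGen
        (fun a b => ∃ f, h.bd f = a ∧ h.bd (lamInv f) = b) A ⟨_, h.root_mem⟩ := by
      intro A
      refine h.ascend_induction (p := fun A => Relation.ReflTransGen
        (fun a b => ∃ f, h.bd f = a ∧ h.bd (lamInv f) = b) A ⟨_, h.root_mem⟩) A fun B ih => ?_
      by_cases hB : B.1 = {r}ᶜ
      · rw [show B = ⟨_, h.root_mem⟩ from Subtype.ext hB]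
      · refine Relation.ReflTransGen.head ⟨Sum.inl B, rfl, ?_⟩ (ih hB)
        rw [lamInv_inl hB]
        rfl
    exact fun v w => (key v).trans (Relation.ReflTransGen.stdSymm.symm _ _ (key w))
  tree_count := h.card_edges

lemma mem_vside_tree {A B : 𝓛} (hA : A.1 ≠ {r}ᶜ) :
    B ∈ h.tree.vside (Sum.inl A) ↔ B.1 ⊆ A.1 := by
  constructor
  · intro hB
    induction hB using Relation.ReflTransGen.head_induction_on with
    | refl => exact subset_rfl
    | head hadj _ ih =>
      obtain ⟨g, h1, h2, rfl, rfl⟩ := hadj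
      have h2 : g ≠ lamInv (Sum.inl A) := h2
      rw [lamInv_inl hA] at h2
      rcases g with C | X
      · change (h.bd (lamInv (Sum.inl C))).1 ⊆ A.1 at ih
        change C.1 ⊆ A.1
        by_cases hC : C.1 = {r}ᶜ
        · rwa [lamInv_inl_root hC] at ih
        · rw [lamInv_inl hC] at ih
          exact (h.ssubset_parent _).1.trans ih
      · change (h.bd (lamInv (Sum.inr X))).1 ⊆ A.1 at ih
        change (h.parent X).1 ⊆ A.1
        by_cases hX : X.1 ∈ 𝓛
        · rw [lamInv_inr hX] at ih
          refine h.parent_subset X A.2 (LE.le.ssubset_of_ne ih fun h' => h2 ?_)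
          exact congrArg _ (Subtype.ext h')
        · rwa [lamInv_inr_leaf hX] at ih
  · refine h.ascend_induction (p := fun B => B.1 ⊆ A.1 → B ∈ h.tree.vside (Sum.inl A)) B
      fun B ih hB => ?_
    by_cases hBA : B = A
    · rw [hBA]
      exact h.tree.bd_mem_vside (Sum.inl A)
    · have hlt : B.1 ⊂ A.1 := hB.ssubset_of_ne fun h' => hBA (Subtype.ext h')
      have hBr : B.1 ≠ {r}ᶜ := fun h' => hlt.2 (h' ▸ h.subset_root A.2)
      refine Relation.ReflTransGen.head ⟨Sum.inl B, fun h' => hBA (Sum.inl_injective h'),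
        fun h' => ?_, rfl, ?_⟩ (ih hBr (h.parent_subset _ A.2 hlt))
      · change Sum.inl B = lamInv (Sum.inl A) at h'
        rw [lamInv_inl hA] at h'
        exact Sum.inl_ne_inr h'
      · change h.bd (lamInv (Sum.inl B)) = _
        rw [lamInv_inl hBr]
        rfl

lemma flagSide_tree {A : 𝓛} (hA : A.1 ≠ {r}ᶜ) : h.tree.flagSide (Sum.inl A) = A.1 := by
  ext s
  rw [LTree.mem_flagSide]
  change h.bd (h.label s) ∈ h.tree.vside (Sum.inl A) ↔ _
  rw [h.mem_vside_tree hA]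
  by_cases hs : s = r
  · rw [hs, h.label_root]
    exact ⟨fun h' => absurd (Set.Subset.antisymm (h.subset_root A.2) h') hA,
      fun h' => absurd h' (h.notMem A.1 A.2)⟩
  · rw [h.label_of_ne hs]
    exact ⟨fun h' => h' ((h.ssubset_parent ⟨_, h.isChild_singleton hs⟩).1 rfl),
      fun h' => h.parent_subset _ A.2 ((h.singleton_ssubset A.2).2 h')⟩

lemma inv_tree_ne {A : 𝓛} (hA : A.1 ≠ {r}ᶜ) : h.tree.inv (Sum.inl A) ≠ Sum.inl A :=
  lamInv_inl_ne_iff.2 hA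

lemma edgeFamily_tree :
    h.tree.edgeFamily = {σ | ∃ A ∈ 𝓛, A ≠ {r}ᶜ ∧ σ = {A, Aᶜ}} := by
  have key : ∀ A : 𝓛, A.1 ≠ {r}ᶜ → h.tree.flagPartition (Sum.inl A) = {A.1, A.1ᶜ} := by
    intro A hA
    rw [LTree.flagPartition_eq (h.inv_tree_ne hA), h.flagSide_tree hA]
  ext σ
  constructor
  · rintro ⟨A | X, hf, rfl⟩
    · have hA := lamInv_inl_ne_iff.1 hf
      exact ⟨A.1, A.2, hA, key A hA⟩
    · have hX := lamInv_inr_ne_iff.1 hf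
      refine ⟨X.1, hX, X.2.2, ?_⟩
      rw [← key ⟨X.1, hX⟩ X.2.2, ← LTree.flagPartition_inv]
      change h.tree.flagPartition (lamInv (Sum.inr X)) = _
      rw [lamInv_inr hX]
  · rintro ⟨A, hA, hAr, rfl⟩
    exact ⟨Sum.inl ⟨A, hA⟩, h.inv_tree_ne hAr, key ⟨A, hA⟩ hAr⟩

lemma mem_branchLabels_child {X : {X // IsChild r 𝓛 X}} {s : γ} (hs : s ∈ X.1) :
    s ∈ h.tree.branchLabels (h.parent X) (Sum.inr X) := by
  by_cases hX : X.1 ∈ 𝓛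
  · have hinv : h.tree.inv (Sum.inr X) = Sum.inl ⟨X.1, hX⟩ := lamInv_inr hX
    rw [LTree.branchLabels_edge (τ := h.tree) (v := h.parent X) (φ := Sum.inr X)
      (lamInv_inr_ne_iff.2 hX) rfl, hinv,
      h.flagSide_tree (A := ⟨X.1, hX⟩) X.2.2]
    exact hs
  · obtain ⟨t, ht, hXt⟩ := X.2.1.resolve_left hX
    have hst : s = t := by rwa [hXt] at hs
    refine Or.inl ?_
    change h.label s = _
    rw [hst, h.label_of_ne ht]
    exact congrArg _ (Subtype.ext hXt.symm)

lemma mem_branchLabels_root (A : 𝓛) : r ∈ h.tree.branchLabels A (Sum.inl A) := by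
  by_cases hA : A.1 = {r}ᶜ
  · refine Or.inl ?_
    change h.label r = _
    rw [h.label_root]
    exact congrArg _ (Subtype.ext hA.symm)
  · have hinv := h.inv_tree_ne hA
    rw [LTree.branchLabels_edge (v := A) hinv rfl, LTree.flagSide_inv _ hinv, h.flagSide_tree hA]
    exact h.notMem A.1 A.2

lemma paintedStable_tree : h.tree.PaintedStable W := by
  constructor
  · intro A
    change 2 < (h.tree.flagsAt A).ncard
    obtain ⟨s, hs⟩ := h.nonempty A.2
    obtain ⟨X, -, hX⟩ := h.exists_child A hs
    obtain ⟨t, ht, htX⟩ := Set.exists_of_ssubset (hX ▸ h.ssubset_parent X)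
    obtain ⟨Y, htY, hY⟩ := h.exists_child A ht
    refine (Set.two_lt_ncard_iff (Set.toFinite _)).2
      ⟨Sum.inl A, Sum.inr X, Sum.inr Y, rfl, hX, hY, Sum.inl_ne_inr, Sum.inl_ne_inr, fun h' => ?_⟩
    exact htX (Sum.inr_injective h' ▸ htY)
  · intro A hcard
    have hsub := Finite.card_le_one_iff_subsingleton.1 hcard
    have leaf : ∀ w ∈ W, w ≠ r → w ∈ A.1 →
        (∀ X, h.parent X = A → w ∈ X.1 → X.1 ∉ 𝓛) → ∃ s ∈ W, h.tree.bd (h.tree.label s) = A := by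
      intro w hwW hwr hw hno
      obtain ⟨Y, hwY, hY⟩ := h.exists_child A hw
      obtain ⟨t, ht, hYt⟩ := Y.2.1.resolve_left (hno Y hY hwY)
      have hwt : w = t := by rwa [hYt] at hwY
      refine ⟨w, hwW, ?_⟩
      change h.bd (h.label w) = A
      rw [h.label_of_ne hwr, ← hY]
      exact congrArg h.parent (Subtype.ext (show {w} = Y.1 by rw [hYt, hwt]))
    by_cases hA : A.1 = {r}ᶜ
    · have root : r ∈ W → ∃ s ∈ W, h.tree.bd (h.tree.label s) = A := by
        intro hrW
        refine ⟨r, hrW, ?_⟩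
        change h.bd (h.label r) = A
        rw [h.label_root]
        exact Subtype.ext hA.symm
      by_cases hX : ∃ X, h.parent X = A ∧ X.1 ∈ 𝓛
      · obtain ⟨X, hXA, hX⟩ := hX
        obtain ⟨w, hw, hwW⟩ := h.white_compl X.1 hX X.2.2
        by_cases hwr : w = r
        · exact root (hwr ▸ hwW)
        refine leaf w hwW hwr (by rw [hA]; exact hwr) fun Y hY hwY hYm => ?_
        have := hsub.elim ⟨Sum.inr X, hXA, lamInv_inr_ne_iff.2 hX⟩
          ⟨Sum.inr Y, hY, lamInv_inr_ne_iff.2 hYm⟩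
        exact hw (Sum.inr_injective (congrArg Subtype.val this) ▸ hwY)
      · obtain ⟨w, hw, hwW⟩ := h.white A.1 A.2
        refine leaf w hwW (fun h' => h.notMem A.1 A.2 (h' ▸ hw)) hw fun Y hY _ hYm => ?_
        exact hX ⟨Y, hY, hYm⟩
    · obtain ⟨w, hw, hwW⟩ := h.white A.1 A.2
      refine leaf w hwW (fun h' => h.notMem A.1 A.2 (h' ▸ hw)) hw fun Y hY _ hYm => ?_
      have := hsub.elim ⟨Sum.inl A, rfl, lamInv_inl_ne_iff.2 hA⟩
        ⟨Sum.inr Y, hY, lamInv_inr_ne_iff.2 hYm⟩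
      exact Sum.inl_ne_inr (congrArg Subtype.val this)

end IsRootedLaminar

end Laminar

section Realization

variable {γ : Type} {W : Set γ}

/-- The members of the partitions in `F` that avoid the label `r`, together with the set of all
labels other than `r`. -/
def rootedFamily (F : Finset (PSP γ W)) (r : γ) : Set (Set γ) :=
  {A | A = {r}ᶜ ∨ (r ∉ A ∧ ∃ p ∈ F, A ∈ p.1)}

variable [Finite γ] {F : Finset (PSP γ W)}

lemma isRootedLaminar_rootedFamily (h3 : 3 ≤ Nat.card γ) (hW : 2 ≤ W.ncard)
    (hF : IsFace (PSCompat γ W) F) (r : γ) : IsRootedLaminar W r (rootedFamily F r) where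
  root_mem := Or.inl rfl
  notMem := by
    rintro A (rfl | h)
    exacts [fun h => h rfl, h.1]
  two_le := by
    rintro A (rfl | ⟨-, p, -, hA⟩)
    · have := Set.ncard_add_ncard_compl ({r} : Set γ)
      rw [Set.ncard_singleton] at this
      omega
    · exact (p.2.2 A hA).2
  nested := by
    rintro A (rfl | ⟨hrA, p, hp, hA⟩) B (rfl | ⟨hrB, q, hq, hB⟩)
    · exact Or.inl subset_rfl
    · exact Or.inr (Or.inl (Set.subset_compl_singleton_iff.2 hrB))
    · exact Or.inl (Set.subset_compl_singleton_iff.2 hrA)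
    · by_cases hpq : p = q
      · subst hpq
        rw [p.2.eq_pair hA] at hB
        rcases hB with rfl | rfl
        · exact Or.inl subset_rfl
        · exact absurd hrA hrB
      · by_contra! hcon
        obtain ⟨h1, h2, h3⟩ := hcon
        obtain ⟨x, hx, hx'⟩ := Set.not_subset.1 h1
        obtain ⟨y, hy, hy'⟩ := Set.not_subset.1 h2
        obtain ⟨z, hz, hz'⟩ := Set.not_disjoint_iff.1 h3
        exact not_crossing_of_isFace hF hp hq hA hB hpq
          ⟨⟨z, hz, hz'⟩, ⟨x, hx, hx'⟩, ⟨y, hy', hy⟩, ⟨r, hrA, hrB⟩⟩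
  white := by
    rintro A (rfl | ⟨-, p, -, hA⟩)
    · obtain ⟨w, hw, hwr⟩ := Set.exists_ne_of_one_lt_ncard hW r
      exact ⟨w, hwr, hw⟩
    · exact (p.2.2 A hA).1
  white_compl := by
    rintro A (rfl | ⟨-, p, -, hA⟩) hne
    · exact absurd rfl hne
    · refine (p.2.2 Aᶜ ?_).1
      rw [p.2.eq_pair hA]
      exact Or.inr rfl

lemma famFinset_edgeFamily_tree {r : γ} (h : IsRootedLaminar W r (rootedFamily F r)) :
    famFinset W h.tree.edgeFamily = F := by
  ext p
  rw [mem_famFinset, h.edgeFamily_tree]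
  constructor
  · rintro ⟨A, hA | ⟨-, q, hq, hA⟩, hne, hp⟩
    · exact absurd hA hne
    · rwa [show p = q from Subtype.ext (hp.trans (q.2.eq_pair hA).symm)]
  · intro hp
    obtain ⟨A, hA, hr⟩ := p.2.exists_eq_mem r
    have hAm : A ∈ p.1 := by rw [hA]; simp
    have hAm' : Aᶜ ∈ p.1 := by rw [hA]; simp
    refine ⟨Aᶜ, Or.inr ⟨fun h' => h' hr, p, hp, hAm'⟩, fun h' => ?_, p.2.eq_pair hAm'⟩
    have := (p.2.2 A hAm).2
    rw [compl_injective h', Set.ncard_singleton] at this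
    omega

lemma linkRel_epsForm_eq_zero (k : Type) [CommRing k] {i j a b : γ} {p : PSP γ W} (hp : p ∈ F)
    {A : Set γ} (hA : A ∈ p.1) (hi : i ∈ A) (ha : a ∈ A) (hj : j ∉ A) (hb : b ∉ A) :
    linkRel (faceEquiv γ W) F (epsForm W k i j a b) = 0 := by
  refine Finset.sum_eq_zero fun q hq => ?_
  rw [Finset.mem_compl] at hq
  by_cases h0 : eps q.1 i j a b = 0
  · rw [epsForm, h0, Int.cast_zero, zero_smul]
  rw [faceVec_of_not, smul_zero]
  intro hface
  obtain ⟨B, hB⟩ := q.2.exists_eq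
  have hnc := not_crossing_of_isFace hface (Finset.mem_insert_of_mem hp)
    (Finset.mem_insert_self _ _) hA (show B ∈ q.1 by rw [hB]; simp) fun h => hq (h ▸ hp)
  rw [hB, eps_pair_eq_zero_iff] at h0
  refine h0 ⟨fun h => hnc ?_, fun h => hnc ?_, fun h => hnc ?_, fun h => hnc ?_⟩
  · exact ⟨⟨i, hi, h.1⟩, ⟨a, ha, h.2.2.1⟩, ⟨j, hj, h.2.1⟩, ⟨b, hb, h.2.2.2⟩⟩
  · exact ⟨⟨a, ha, h.2.2.1⟩, ⟨i, hi, h.1⟩, ⟨b, hb, h.2.2.2⟩, ⟨j, hj, h.2.1⟩⟩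
  · exact ⟨⟨a, ha, h.1⟩, ⟨i, hi, h.2.2.1⟩, ⟨j, hj, h.2.1⟩, ⟨b, hb, h.2.2.2⟩⟩
  · exact ⟨⟨i, hi, h.2.2.1⟩, ⟨a, ha, h.1⟩, ⟨b, hb, h.2.2.2⟩, ⟨j, hj, h.2.1⟩⟩

lemma exists_allowedFlags (h3 : 3 ≤ Nat.card γ) (hW : 2 ≤ W.ncard)
    (hF : IsFace (PSCompat γ W) F) {i j a b : γ} (hal : Allowed W i j a b)
    (h0 : ∀ p ∈ F, eps p.1 i j a b = 0)
    (hns : ∀ p ∈ F, ∀ A ∈ p.1, ¬ (i ∈ A ∧ a ∈ A ∧ j ∉ A ∧ b ∉ A)) :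
    ∃ τ : LTree γ, τ.PaintedStable W ∧ famFinset W τ.edgeFamily = F ∧
      ∃ (v : τ.V) (I J K L : τ.Fl), I ∈ τ.flagsAt v ∧ J ∈ τ.flagsAt v ∧ K ∈ τ.flagsAt v ∧
        L ∈ τ.flagsAt v ∧ I ≠ J ∧ I ≠ K ∧ I ≠ L ∧ J ≠ K ∧ J ≠ L ∧ K ≠ L ∧
        i ∈ τ.branchLabels v I ∧ j ∈ τ.branchLabels v J ∧ a ∈ τ.branchLabels v K ∧
        b ∈ τ.branchLabels v L := by
  have h := isRootedLaminar_rootedFamily h3 hW hF i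
  obtain ⟨hij, hia, hib, hja, hjb, hab, -⟩ := hal
  obtain ⟨A, ⟨hA, hjA, haA⟩, hmin⟩ := Set.Finite.exists_minimal
    (Set.toFinite {A | A ∈ rootedFamily F i ∧ j ∈ A ∧ a ∈ A}) ⟨_, h.root_mem, hij.symm, hia.symm⟩
  have hbA : b ∈ A := by
    by_contra hbA
    rcases hA with rfl | ⟨hiA, p, hp, hA⟩
    · exact hbA hib.symm
    · have := h0 p hp
      rw [p.2.eq_pair hA, eps_pair_eq_zero_iff] at this
      exact this.2.2.1 ⟨haA, hjA, hiA, hbA⟩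
  have hpart : ∀ (X : {X // IsChild i (rootedFamily F i) X}) {s t : γ}, s ≠ t → s ∈ X.1 →
      t ∈ X.1 → X.1 ∈ rootedFamily F i ∧ i ∉ X.1 ∧ ∃ p ∈ F, X.1 ∈ p.1 := by
    intro X s t hst hs ht
    have hX : X.1 ∈ rootedFamily F i := X.2.1.resolve_right fun ⟨x, _, hx⟩ => by
      rw [hx] at hs ht
      exact hst (hs.trans ht.symm)
    exact ⟨hX, hX.resolve_left X.2.2⟩
  have hsmall : ∀ X, h.parent X = ⟨A, hA⟩ → ¬ (j ∈ X.1 ∧ a ∈ X.1) := by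
    intro X hXA hX
    have hlt := h.ssubset_parent X
    rw [hXA] at hlt
    exact hlt.2 (hmin ⟨(hpart X hja hX.1 hX.2).1, hX⟩ hlt.1)
  obtain ⟨X, hjX, hX⟩ := h.exists_child ⟨A, hA⟩ hjA
  obtain ⟨Y, haY, hY⟩ := h.exists_child ⟨A, hA⟩ haA
  obtain ⟨Z, hbZ, hZ⟩ := h.exists_child ⟨A, hA⟩ hbA
  have haX : a ∉ X.1 := fun h' => hsmall X hX ⟨hjX, h'⟩
  have hjY : j ∉ Y.1 := fun h' => hsmall Y hY ⟨h', haY⟩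
  have hbX : b ∉ X.1 := by
    intro hbX
    obtain ⟨-, hiX, p, hp, hXp⟩ := hpart X hjb hjX hbX
    refine hns p hp X.1ᶜ ?_ ⟨hiX, haX, fun h' => h' hjX, fun h' => h' hbX⟩
    rw [p.2.eq_pair hXp]
    exact Or.inr rfl
  have hbY : b ∉ Y.1 := by
    intro hbY
    obtain ⟨-, hiY, p, hp, hYp⟩ := hpart Y hab haY hbY
    have := h0 p hp
    rw [p.2.eq_pair hYp, eps_pair_eq_zero_iff] at this
    exact this.2.1 ⟨hiY, hjY, haY, hbY⟩
  refine ⟨h.tree, h.paintedStable_tree, famFinset_edgeFamily_tree h, ⟨A, hA⟩, Sum.inl ⟨A, hA⟩,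
    Sum.inr X, Sum.inr Y, Sum.inr Z, rfl, hX, hY, hZ, Sum.inl_ne_inr, Sum.inl_ne_inr,
    Sum.inl_ne_inr, fun h' => ?_, fun h' => ?_, fun h' => ?_, h.mem_branchLabels_root _, ?_, ?_,
    ?_⟩
  · exact haX (Sum.inr_injective h' ▸ haY)
  · exact hbX (Sum.inr_injective h' ▸ hbZ)
  · exact hbY (Sum.inr_injective h' ▸ hbZ)
  · exact hX ▸ h.mem_branchLabels_child hjX
  · exact hY ▸ h.mem_branchLabels_child haY
  · exact hZ ▸ h.mem_branchLabels_child hbZ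

lemma linkRel_epsForm_mem_JS (k : Type) [CommRing k] (h3 : 3 ≤ Nat.card γ) (hW : 2 ≤ W.ncard)
    (hF : IsFace (PSCompat γ W) F) {i j a b : γ} (hal : Allowed W i j a b)
    (h0 : ∀ p ∈ F, eps p.1 i j a b = 0) :
    linkRel (faceEquiv γ W) F (epsForm W k i j a b) ∈ JS γ W k := by
  by_cases hns : ∀ p ∈ F, ∀ A ∈ p.1, ¬ (i ∈ A ∧ a ∈ A ∧ j ∉ A ∧ b ∉ A)
  · obtain ⟨τ, hτ, rfl, v, I, J, K, L, hI, hJ, hK, hL, hIJ, hIK, hIL, hJK, hJL, hKL, hi, hj, ha,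
      hb⟩ := exists_allowedFlags h3 hW hF hal h0 hns
    rw [← LTree.stdRelH_eq_linkRel k hτ hI hJ hK hL hIJ hJK hIL hKL hi hj ha hb]
    exact Submodule.subset_span ⟨τ, hτ, v, I, J, K, L, ⟨hI, hJ, hK, hL, hIJ, hIK, hIL, hJK, hJL,
      hKL, i, hi, j, hj, a, ha, b, hb, hal⟩, rfl⟩
  · push Not at hns
    obtain ⟨p, hp, A, hA, hi, ha, hj, hb⟩ := hns
    rw [linkRel_epsForm_eq_zero k hp hA hi ha hj hb]
    exact zero_mem _

end Realization

section Presentation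

variable {γ : Type} {W : Set γ}

lemma exists_splitsPair_of_crossing {p q : PSP γ W} {A B : Set γ} (hA : A ∈ p.1) (hB : B ∈ q.1)
    (hAB : Crossing A B) : ∃ i j a b : γ, Allowed W i j a b ∧ SplitsPair p.1 i j a b ∧
      SplitsPair q.1 a j i b := by
  obtain ⟨hpA, hpA'⟩ := paintedStablePart_pair_iff.1 (p.2.eq_pair hA ▸ p.2)
  obtain ⟨hqB, hqB'⟩ := paintedStablePart_pair_iff.1 (q.2.eq_pair hB ▸ q.2)
  obtain ⟨⟨x, hxA, hxB⟩, ⟨y, hyA, hyB⟩, ⟨z, hzA, hzB⟩, ⟨w, hwA, hwB⟩⟩ := hAB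
  have key : ∀ x y w z : γ, x ∈ A → x ∈ B → y ∈ A → y ∉ B → w ∉ A → w ∉ B → z ∉ A → z ∈ B →
      (x ∈ W ∧ w ∈ W) ∨ (y ∈ W ∧ z ∈ W) → ∃ i j a b : γ, Allowed W i j a b ∧
        SplitsPair p.1 i j a b ∧ SplitsPair q.1 a j i b := by
    intro x y w z hxA hxB hyA hyB hwA hwB hzA hzB h
    refine ⟨x, y, w, z, ⟨?_, ?_, ?_, ?_, ?_, ?_, by tauto⟩, ?_, ?_⟩
    · exact fun h => hyB (h ▸ hxB)
    · exact fun h => hwA (h ▸ hxA)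
    · exact fun h => hzA (h ▸ hxA)
    · exact fun h => hwA (h ▸ hyA)
    · exact fun h => hzA (h ▸ hyA)
    · exact fun h => hwB (h ▸ hzB)
    · rw [p.2.eq_pair hA, splitsPair_pair_iff]
      exact Or.inl ⟨hxA, hyA, hwA, hzA⟩
    · rw [q.2.eq_pair hB, splitsPair_pair_iff]
      exact Or.inr ⟨hwB, hyB, hxB, hzB⟩
  by_cases h : (∃ s, (s ∈ A ∧ s ∈ B) ∧ s ∈ W) ∧ ∃ s, (s ∉ A ∧ s ∉ B) ∧ s ∈ W
  · obtain ⟨⟨s, hs, hsW⟩, t, ht, htW⟩ := h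
    exact key s y t z hs.1 hs.2 hyA hyB ht.1 ht.2 hzA hzB (Or.inl ⟨hsW, htW⟩)
  · have h' : (∃ s, (s ∈ A ∧ s ∉ B) ∧ s ∈ W) ∧ ∃ s, (s ∉ A ∧ s ∈ B) ∧ s ∈ W := by
      obtain ⟨s, hs, hsW⟩ := hpA.1
      obtain ⟨t, ht, htW⟩ := hpA'.1
      obtain ⟨u, hu, huW⟩ := hqB.1
      obtain ⟨v, hv, hvW⟩ := hqB'.1
      by_cases h1 : ∃ s, (s ∈ A ∧ s ∈ B) ∧ s ∈ W
      · have h2 := fun h2 => h ⟨h1, h2⟩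
        exact ⟨⟨v, ⟨not_not.1 fun h3 => h2 ⟨v, ⟨h3, hv⟩, hvW⟩, hv⟩, hvW⟩,
          ⟨t, ⟨ht, not_not.1 fun h3 => h2 ⟨t, ⟨ht, h3⟩, htW⟩⟩, htW⟩⟩
      · exact ⟨⟨s, ⟨hs, fun h3 => h1 ⟨s, ⟨hs, h3⟩, hsW⟩⟩, hsW⟩,
          ⟨u, ⟨fun h3 => h1 ⟨u, ⟨h3, hu⟩, huW⟩, hu⟩, huW⟩⟩
    obtain ⟨⟨s, hs, hsW⟩, t, ht, htW⟩ := h'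
    exact key x s w t hxA hxB hs.1 hs.2 hwA hwB ht.1 ht.2 (Or.inr ⟨hsW, htW⟩)

lemma not_psCompat_iff {p q : PSP γ W} (hpq : p ≠ q) : ¬ PSCompat γ W p q ↔
    ∃ i j a b : γ, Allowed W i j a b ∧ SplitsPair p.1 i j a b ∧ SplitsPair q.1 a j i b := by
  obtain ⟨A, hA⟩ := p.2.exists_eq
  obtain ⟨B, hB⟩ := q.2.exists_eq
  have hc : PSCompat γ W p q ↔ ¬ Crossing A B := by
    rw [PSCompat, hA, hB]
    exact delta_eq_one_iff_of_painted (hA ▸ p.2) (hB ▸ q.2)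
      fun h => hpq (Subtype.ext (hA.trans (h.trans hB.symm)))
  rw [hc, not_not]
  constructor
  · exact exists_splitsPair_of_crossing (by rw [hA]; simp) (by rw [hB]; simp)
  · rintro ⟨i, j, a, b, -, h1, h'⟩
    rw [hA, splitsPair_pair_iff] at h1
    rw [hB, splitsPair_pair_iff] at h'
    rcases h1 with ⟨h1, h2, h3, h4⟩ | ⟨h1, h2, h3, h4⟩ <;>
      rcases h' with ⟨h5, h6, h7, h8⟩ | ⟨h5, h6, h7, h8⟩
    · exact ⟨⟨j, h2, h6⟩, ⟨i, h1, h7⟩, ⟨a, h3, h5⟩, ⟨b, h4, h8⟩⟩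
    · exact ⟨⟨i, h1, h7⟩, ⟨j, h2, h6⟩, ⟨b, h4, h8⟩, ⟨a, h3, h5⟩⟩
    · exact ⟨⟨a, h3, h5⟩, ⟨b, h4, h8⟩, ⟨j, h2, h6⟩, ⟨i, h1, h7⟩⟩
    · exact ⟨⟨b, h4, h8⟩, ⟨a, h3, h5⟩, ⟨i, h1, h7⟩, ⟨j, h2, h6⟩⟩

lemma ne_of_splitsPair {p q : PSP γ W} {i j a b : γ} (h : SplitsPair p.1 i j a b)
    (h' : SplitsPair q.1 a j i b) : p ≠ q := by
  rintro rfl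
  obtain ⟨A, hA⟩ := p.2.exists_eq
  rw [hA, splitsPair_pair_iff] at h h'
  tauto

variable [Finite γ] (k : Type) [CommRing k]

lemma linkSpan_eq_JS (h3 : 3 ≤ Nat.card γ) (hW : 2 ≤ W.ncard) :
    linkSpan (faceEquiv γ W) (epsSpan W k) = JS γ W k := by
  apply le_antisymm
  · refine Submodule.span_le.2 ?_
    rintro _ ⟨F, l, hF, hl, h0, rfl⟩
    have key : unsplitSpan W k F ≤ (JS γ W k).comap
        (∑ q ∈ Fᶜ, (LinearMap.proj q : (PSP γ W → k) →ₗ[k] k).smulRight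
          (faceVec (faceEquiv γ W) (insert q F))) := by
      refine Submodule.span_le.2 ?_
      rintro _ ⟨i, j, a, b, hal, h0, rfl⟩
      simpa [linkRel] using linkRel_epsForm_mem_JS k h3 hW hF hal h0
    simpa [linkRel] using key (mem_unsplitSpan_of_vanish k hF hl h0)
  · refine Submodule.span_le.2 ?_
    rintro _ ⟨τ, hτ, v, I, J, K, L, ⟨hI, hJ, hK, hL, hIJ, -, hIL, hJK, -, hKL, i, hi, j, hj, a, ha,
      b, hb, hal⟩, rfl⟩
    rw [LTree.stdRelH_eq_linkRel k hτ hI hJ hK hL hIJ hJK hIL hKL hi hj ha hb]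
    refine Submodule.subset_span ⟨_, _, isFace_famFinset (LTree.goodFamily_edgeFamily hτ),
      Submodule.subset_span ⟨i, j, a, b, hal, rfl⟩, fun q hq => ?_, rfl⟩
    rw [epsForm, LTree.eps_edgeFamily_eq_zero hI hJ hK hL hIJ hJK hIL hKL hi hj ha hb
      (mem_famFinset.1 hq), Int.cast_zero]

lemma Rquad_eq_sum (i j a b : γ) : Rquad γ W k i j a b =
    ∑ p, MvPolynomial.C (epsForm W k i j a b p) * MvPolynomial.X p := by
  rw [Rquad, finsum_eq_sum_of_fintype]
  refine Finset.sum_congr rfl fun p _ => ?_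
  rw [epsForm, zsmul_eq_mul, map_intCast]

lemma sum_mem_idealI {l : PSP γ W → k} (hl : l ∈ epsSpan W k) :
    ∑ p, MvPolynomial.C (l p) * MvPolynomial.X p ∈ idealI γ W k := by
  induction hl using Submodule.span_induction with
  | mem l h =>
    obtain ⟨i, j, a, b, hal, rfl⟩ := h
    rw [← Rquad_eq_sum]
    exact Ideal.subset_span (Or.inl ⟨i, j, a, b, hal, rfl⟩)
  | zero => simp
  | add l l' _ _ h h' =>
    simp only [Pi.add_apply, map_add, add_mul, Finset.sum_add_distrib]
    exact add_mem h h'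
  | smul c l _ h =>
    simp only [Pi.smul_apply, smul_eq_mul, map_mul, mul_assoc, ← Finset.mul_sum]
    exact Ideal.mul_mem_left _ _ h

lemma mFam_eq_prod (E : GoodFam γ W) :
    mFam γ W k E.1 = ∏ p ∈ (faceEquiv γ W E).1, MvPolynomial.X p := by
  have hE : E.1 = Subtype.val '' ((faceEquiv γ W E).1 : Set (PSP γ W)) :=
    congrArg Subtype.val ((faceEquiv γ W).symm_apply_apply E).symm
  rw [mFam]
  conv_lhs => rw [hE]
  rw [finprod_mem_image Subtype.val_injective.injOn, finprod_mem_coe_finset]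
  exact Finset.prod_congr rfl fun p _ => dif_pos p.2

end Presentation

/-- **Corollary 2.3.1(b).** The `k`-linear map `M_S → H*_S`,
`μ(τ) ↦ [m(τ)]`, vanishes exactly on `J_S` and is surjective; hence the induced map
`H_{*S} → H*_S` is an isomorphism of `k`-modules, i.e. the standard relations span all
`k`-linear relations between the classes of good monomials in `H*_S`. -/
theorem homology_cohomology_iso {γ : Type} [Finite γ] (W : Set γ)
    (k : Type) [CommRing k]
    (h3 : 3 ≤ Nat.card γ) (hW : 2 ≤ W.ncard) :
    LinearMap.ker (sMap γ W k) = JS γ W k ∧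
    LinearMap.range (sMap γ W k) = ⊤ := by
  rw [← linkSpan_eq_JS k h3 hW]
  refine face_presentation (faceEquiv γ W) (unimodular_epsSpan k) (idealI γ W k)
    (fun l hl => sum_mem_idealI k hl) (fun p q hpq h => ?_) ?_ (sMap γ W k) fun E => ?_
  · exact Ideal.subset_span (Or.inr ⟨p, q, (not_psCompat_iff hpq).1 h, rfl⟩)
  · refine Ideal.span_mono ?_
    rintro _ (⟨i, j, a, b, hal, rfl⟩ | ⟨p, q, h, rfl⟩)
    · exact Or.inl ⟨_, Submodule.subset_span ⟨i, j, a, b, hal, rfl⟩, Rquad_eq_sum k i j a b⟩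
    · have hpq : p ≠ q := by
        obtain ⟨i, j, a, b, -, h1, h2⟩ := h
        exact ne_of_splitsPair h1 h2
      exact Or.inr ⟨p, q, hpq, (not_psCompat_iff hpq).2 h, rfl⟩
  · rw [sMap, Finsupp.linearCombination_single, one_smul, mFam_eq_prod]

end EMO
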